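/- arXiv:math/0009065 — 2 statements merged into one kernel-verified Lean document; each statement's English description precedes it below -/
import Mathlib

section
/- Let g be a C^{3,1} function on ℝ × [0,1] with g(x,0) = g(x,1) = 0 for all x, and suppose that for every β > 0 there is c_β with |g(x,t)| + |∂_x g(x,t)| + |∂_x² g(x,t)| ≤ c_β e^{−β|x|} for all (x,t). Then ‖e^{λx} g‖_{L⁸(ℝ×[0,1])} ≤ c₀ ‖e^{λx}(∂_t g + ∂_x³ g)‖_{L^{8/7}(ℝ×[0,1])} for all λ ∈ ℝ, with c₀ independent of λ. -/
open MeasureTheory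

noncomputable def pdx (f : ℝ × ℝ → ℝ) : ℝ × ℝ → ℝ := fun p => deriv (fun x => f (x, p.2)) p.1
noncomputable def pdt (f : ℝ × ℝ → ℝ) : ℝ × ℝ → ℝ := fun p => deriv (fun t => f (p.1, t)) p.2

/-- `f ∈ C^{3,1}`: three continuous spatial derivatives and one continuous time derivative. -/
def C31 (f : ℝ × ℝ → ℝ) : Prop :=
  (∀ t, ContDiff ℝ 3 (fun x => f (x, t))) ∧ (∀ x, Differentiable ℝ (fun t => f (x, t))) ∧
  Continuous f ∧ Continuous (pdx f) ∧ Continuous (pdx (pdx f)) ∧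
  Continuous (pdx (pdx (pdx f))) ∧ Continuous (pdt f)

section Plancherel
open FourierTransform SchwartzMap TemperedDistribution
open scoped ContDiff

theorem continuous_fourier_of_integrable {f : ℝ → ℂ} (hf : Integrable f) : Continuous (𝓕 f) := by
  exact VectorFourier.fourierIntegral_continuous Real.continuous_fourierChar
    (by exact continuous_inner) hf

theorem fourier_toLp_ae_eq {f : ℝ → ℂ} (hf : Integrable f) (hf2 : MemLp f 2) :
    (𝓕 (hf2.toLp f) : Lp ℂ 2 (volume : Measure ℝ)) =ᵐ[volume] 𝓕 f := by
  apply ae_eq_of_integral_contDiff_smul_eq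
  · exact (Lp.memLp _).locallyIntegrable (by norm_num)
  · exact (continuous_fourier_of_integrable hf).locallyIntegrable
  intro g hg hgc
  have hg₁ : HasCompactSupport (Complex.ofRealCLM ∘ g) := hgc.comp_left rfl
  have hg₂ : ContDiff ℝ ∞ (Complex.ofRealCLM ∘ g) := by fun_prop
  set G : 𝓢(ℝ, ℂ) := hg₁.toSchwartzMap hg₂ with hG
  have hGg : ∀ x, G x = (g x : ℂ) := fun x => by simp [hG]
  have h1 := congrArg (fun T : 𝓢'(ℝ, ℂ) => T G)
    (Lp.fourier_toTemperedDistribution_eq (hf2.toLp f))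
  simp only [TemperedDistribution.fourier_apply, Lp.toTemperedDistribution_apply] at h1
  have h2 : ∫ x, g x • (𝓕 (hf2.toLp f) : Lp ℂ 2 (volume : Measure ℝ)) x
      = ∫ x, G x • (𝓕 (hf2.toLp f) : Lp ℂ 2 (volume : Measure ℝ)) x := by
    simp [hGg]
  rw [h2, ← h1]
  have h3 : ∫ x, (𝓕 G) x • (hf2.toLp f) x = ∫ x, 𝓕 (G : ℝ → ℂ) x • f x := by
    apply integral_congr_ae
    filter_upwards [hf2.coeFn_toLp] with x hx
    rw [hx, SchwartzMap.fourier_coe]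
  rw [h3]
  have := VectorFourier.integral_fourierIntegral_smul_eq_flip (L := innerₗ ℝ)
    Real.continuous_fourierChar continuous_inner (μ := volume) (ν := volume) G.integrable hf
  calc _ = _ := this
    _ = _ := by
      apply integral_congr_ae
      filter_upwards with x
      rw [hGg]
      simp [Real.fourier_eq, VectorFourier.fourierIntegral]

/-- Plancherel's theorem for functions in `L¹ ∩ L²`. -/
theorem eLpNorm_fourier_of_integrable {f : ℝ → ℂ} (hf : Integrable f) (hf2 : MemLp f 2) :
    eLpNorm (𝓕 f) 2 volume = eLpNorm f 2 volume := by
  rw [← eLpNorm_congr_ae (fourier_toLp_ae_eq hf hf2), ← eLpNorm_congr_ae hf2.coeFn_toLp]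
  have := Lp.norm_fourier_eq (hf2.toLp f)
  rw [Lp.norm_def, Lp.norm_def, ENNReal.toReal_eq_toReal_iff' (Lp.eLpNorm_ne_top _)
    (Lp.eLpNorm_ne_top _)] at this
  exact this

theorem eLpNorm_fourierInv_of_integrable {f : ℝ → ℂ} (hf : Integrable f) (hf2 : MemLp f 2) :
    eLpNorm (𝓕⁻ f) 2 volume = eLpNorm f 2 volume := by
  rw [← eLpNorm_fourier_of_integrable hf hf2]
  have : (𝓕⁻ f) = (𝓕 f) ∘ Neg.neg := by
    ext x; rw [Real.fourierInv_eq_fourier_neg]; rfl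
  rw [this]
  exact eLpNorm_comp_measurePreserving
    (continuous_fourier_of_integrable hf).aestronglyMeasurable (Measure.measurePreserving_neg _)

end Plancherel

section VanDerCorput
open Set Complex intervalIntegral

/-- Integration by parts against a monotone amplitude. -/
theorem norm_integral_monotone_mul_deriv_le {A A' : ℝ → ℝ} {G G' : ℝ → ℂ} {a b M C : ℝ}
    (hab : a ≤ b) (hA : ∀ x ∈ Icc a b, HasDerivAt A (A' x) x)
    (hG : ∀ x ∈ Icc a b, HasDerivAt G (G' x) x)
    (hA' : ContinuousOn A' (Icc a b)) (hG' : ContinuousOn G' (Icc a b))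
    (hmono : (∀ x ∈ Icc a b, 0 ≤ A' x) ∨ (∀ x ∈ Icc a b, A' x ≤ 0))
    (hM : ∀ x ∈ Icc a b, |A x| ≤ M) (hC : ∀ x ∈ Icc a b, ‖G x‖ ≤ C) :
    ‖∫ x in a..b, (A x : ℂ) * G' x‖ ≤ 4 * (M * C) := by
  rw [← uIcc_of_le hab] at hA hG hA' hG'
  have ha : a ∈ Icc a b := ⟨le_rfl, hab⟩
  have hb : b ∈ Icc a b := ⟨hab, le_rfl⟩
  have hC0 : 0 ≤ C := (norm_nonneg _).trans (hC a ha)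
  have hM0 : 0 ≤ M := (abs_nonneg _).trans (hM a ha)
  have hAc : ContinuousOn (fun x => (A' x : ℂ)) (uIcc a b) := by fun_prop
  rw [integral_mul_deriv_eq_deriv_mul (fun x hx => (hA x hx).ofReal_comp) hG
    hAc.intervalIntegrable hG'.intervalIntegrable]
  have hvar : ∫ x in a..b, |A' x| ≤ 2 * M := by
    have key : ∫ x in a..b, A' x = A b - A a :=
      integral_eq_sub_of_hasDerivAt hA hA'.intervalIntegrable
    have h1 := abs_le.1 (hM a ha)
    have h2 := abs_le.1 (hM b hb)
    rcases hmono with h | h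
    · rw [integral_congr (g := A') fun x hx => abs_of_nonneg (h x (uIcc_of_le hab ▸ hx)), key]
      linarith
    · rw [integral_congr (g := fun x => - A' x)
        fun x hx => abs_of_nonpos (h x (uIcc_of_le hab ▸ hx)), intervalIntegral.integral_neg, key]
      linarith
  have hpoint : ‖∫ x in a..b, (A' x : ℂ) * G x‖ ≤ 2 * M * C := by
    have hGc : ContinuousOn G (uIcc a b) := fun x hx => (hG x hx).continuousAt.continuousWithinAt
    calc _ ≤ ∫ x in a..b, ‖(A' x : ℂ) * G x‖ := norm_integral_le_integral_norm hab
      _ ≤ ∫ x in a..b, |A' x| * C := by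
        apply integral_mono_on hab
        · exact (hAc.mul hGc).norm.intervalIntegrable
        · exact (hA'.abs.mul continuousOn_const).intervalIntegrable
        · intro x hx
          rw [norm_mul, norm_real, Real.norm_eq_abs]
          exact mul_le_mul_of_nonneg_left (hC x hx) (abs_nonneg _)
      _ = (∫ x in a..b, |A' x|) * C := by rw [intervalIntegral.integral_mul_const]
      _ ≤ _ := by gcongr
  have e1 : ‖(A b : ℂ) * G b‖ ≤ M * C := by
    rw [norm_mul, norm_real, Real.norm_eq_abs]
    exact mul_le_mul (hM b hb) (hC b hb) (norm_nonneg _) hM0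
  have e2 : ‖(A a : ℂ) * G a‖ ≤ M * C := by
    rw [norm_mul, norm_real, Real.norm_eq_abs]
    exact mul_le_mul (hM a ha) (hC a ha) (norm_nonneg _) hM0
  calc _ ≤ ‖(A b : ℂ) * G b‖ + ‖(A a : ℂ) * G a‖ + ‖∫ x in a..b, (A' x : ℂ) * G x‖ := by
        refine (norm_sub_le _ _).trans ?_
        gcongr
        exact norm_sub_le _ _
    _ ≤ _ := by linarith

/-- The cubic oscillation `exp (i (y ξ + τ ξ³))`. -/
noncomputable def cubicPhase (y τ ξ : ℝ) : ℂ := exp (((y * ξ + τ * ξ ^ 3 : ℝ) : ℂ) * I)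

theorem norm_cubicPhase (y τ ξ : ℝ) : ‖cubicPhase y τ ξ‖ = 1 := norm_exp_ofReal_mul_I _

theorem continuous_cubicPhase (y τ : ℝ) : Continuous (cubicPhase y τ) := by
  unfold cubicPhase; fun_prop

theorem hasDerivAt_cubicPhase (y τ ξ : ℝ) :
    HasDerivAt (cubicPhase y τ) (((y + 3 * τ * ξ ^ 2 : ℝ) : ℂ) * I * cubicPhase y τ ξ) ξ := by
  have h1 : HasDerivAt (fun ξ : ℝ => y * ξ + τ * ξ ^ 3) (y + 3 * τ * ξ ^ 2) ξ := by
    have := ((hasDerivAt_id ξ).const_mul y).add ((hasDerivAt_pow 3 ξ).const_mul τ)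
    refine this.congr_deriv ?_
    push_cast; ring
  have := (h1.ofReal_comp.mul_const I).cexp
  refine this.congr_deriv ?_
  unfold cubicPhase; ring

theorem norm_integral_cubicPhase_le_of_deriv {y τ a b δ : ℝ} (hτ : 0 ≤ τ) (hδ : 0 < δ)
    (ha : 0 ≤ a) (hab : a ≤ b)
    (h : (∀ x ∈ Icc a b, δ ≤ y + 3 * τ * x ^ 2) ∨ (∀ x ∈ Icc a b, y + 3 * τ * x ^ 2 ≤ -δ)) :
    ‖∫ x in a..b, cubicPhase y τ x‖ ≤ 4 / δ := by
  have hne : ∀ x ∈ Icc a b, y + 3 * τ * x ^ 2 ≠ 0 := by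
    intro x hx h0
    rcases h with h | h <;> · have := h x hx; linarith
  have habs : ∀ x ∈ Icc a b, δ ≤ |y + 3 * τ * x ^ 2| := by
    intro x hx
    rcases h with h | h
    · exact (h x hx).trans (le_abs_self _)
    · have := h x hx; exact (by linarith : δ ≤ -(y + 3 * τ * x ^ 2)).trans (neg_le_abs _)
  have key := norm_integral_monotone_mul_deriv_le (A := fun x => (y + 3 * τ * x ^ 2)⁻¹)
    (A' := fun x => -(6 * τ * x) / (y + 3 * τ * x ^ 2) ^ 2)
    (G := fun x => -I * cubicPhase y τ x)
    (G' := fun x => ((y + 3 * τ * x ^ 2 : ℝ) : ℂ) * cubicPhase y τ x) (M := 1 / δ) (C := 1) hab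
    ?_ ?_ ?_ ?_ ?_ ?_ ?_
  · have e : ∫ x in a..b, cubicPhase y τ x = ∫ x in a..b,
        (((y + 3 * τ * x ^ 2)⁻¹ : ℝ) : ℂ) * (((y + 3 * τ * x ^ 2 : ℝ) : ℂ) * cubicPhase y τ x) := by
      apply integral_congr
      intro x hx
      rw [uIcc_of_le hab] at hx
      have := hne x hx
      simp only
      rw [← mul_assoc, ← ofReal_mul, inv_mul_cancel₀ this, ofReal_one, one_mul]
    rw [e]
    refine key.trans (le_of_eq ?_)
    ring
  · intro x hx
    have h1 : HasDerivAt (fun x : ℝ => y + 3 * τ * x ^ 2) (6 * τ * x) x := by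
      have := ((hasDerivAt_pow 2 x).const_mul (3 * τ)).const_add y
      refine this.congr_deriv ?_
      push_cast; ring
    exact h1.inv (hne x hx)
  · intro x _
    refine ((hasDerivAt_cubicPhase y τ x).const_mul (-I)).congr_deriv ?_
    linear_combination (-((y + 3 * τ * x ^ 2 : ℝ) : ℂ) * cubicPhase y τ x) * I_mul_I
  · apply ContinuousOn.div (by fun_prop) (by fun_prop)
    intro x hx; exact pow_ne_zero _ (hne x hx)
  · exact Continuous.continuousOn (by have := continuous_cubicPhase y τ; fun_prop)
  · right
    intro x hx
    have : 0 ≤ x := ha.trans hx.1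
    apply div_nonpos_of_nonpos_of_nonneg _ (by positivity)
    have : 0 ≤ 6 * τ * x := by positivity
    linarith
  · intro x hx
    rw [abs_inv, one_div]
    exact inv_anti₀ hδ (habs x hx)
  · intro x _
    rw [norm_mul, norm_cubicPhase, norm_neg, norm_I, one_mul]

theorem norm_integral_cubicPhase_le {y δ a b : ℝ} (hδ : 0 < δ) (ha : 0 ≤ a) (hab : a ≤ b) :
    ‖∫ x in a..b, cubicPhase y (δ ^ 3) x‖ ≤ 9 / δ := by
  have hδ3 : 0 < 3 * δ ^ 3 := by positivity
  set u₁ := (-δ - y) / (3 * δ ^ 3) with hu₁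
  set u₂ := (δ - y) / (3 * δ ^ 3) with hu₂
  set p₁ := √u₁
  set p₂ := √u₂
  have hp₁ : 0 ≤ p₁ := Real.sqrt_nonneg _
  have hp₂ : 0 ≤ p₂ := Real.sqrt_nonneg _
  have hu : u₁ ≤ u₂ := by rw [hu₁, hu₂]; gcongr; linarith
  have hp : p₁ ≤ p₂ := Real.sqrt_le_sqrt hu
  have hlen : p₂ - p₁ ≤ 1 / δ := by
    have hsq : p₂ ^ 2 - p₁ ^ 2 ≤ (1 / δ) ^ 2 := by
      have hd : u₂ - u₁ = 2 / 3 * (1 / δ) ^ 2 := by rw [hu₁, hu₂]; field_simp; ring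
      have h0 : 0 < (1 / δ) ^ 2 := by positivity
      rcases le_total 0 u₁ with h | h
      · rw [Real.sq_sqrt h, Real.sq_sqrt (h.trans hu)]; linarith
      · have : p₁ = 0 := Real.sqrt_eq_zero_of_nonpos h
        rw [this]
        rcases le_total 0 u₂ with h' | h'
        · rw [Real.sq_sqrt h']; linarith
        · rw [show p₂ = 0 from Real.sqrt_eq_zero_of_nonpos h']; simpa using h0.le
    apply le_of_sq_le_sq _ (by positivity)
    nlinarith
  set c₁ := max a (min b p₁)
  set c₂ := max a (min b p₂)
  have hac₁ : a ≤ c₁ := le_max_left _ _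
  have hc₁₂ : c₁ ≤ c₂ := max_le_max le_rfl (min_le_min le_rfl hp)
  have hc₂b : c₂ ≤ b := max_le hab (min_le_left _ _)
  have hi : ∀ u v, IntervalIntegrable (cubicPhase y (δ ^ 3)) volume u v :=
    fun u v => (continuous_cubicPhase _ _).intervalIntegrable _ _
  rw [← integral_add_adjacent_intervals (hi a c₁) (hi c₁ b),
    ← integral_add_adjacent_intervals (hi c₁ c₂) (hi c₂ b)]
  have h₁ : ‖∫ x in a..c₁, cubicPhase y (δ ^ 3) x‖ ≤ 4 / δ := by
    rcases hac₁.eq_or_lt with h | h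
    · rw [← h, integral_same, norm_zero]; positivity
    apply norm_integral_cubicPhase_le_of_deriv (by positivity) hδ ha hac₁
    right
    intro x hx
    have hcp : c₁ ≤ p₁ := by
      rcases lt_max_iff.1 h with h | h
      · exact absurd h (lt_irrefl _)
      · exact max_le (h.le.trans (min_le_right _ _)) (min_le_right _ _)
    have hu0 : 0 ≤ u₁ := by
      by_contra hneg
      have : p₁ = 0 := Real.sqrt_eq_zero_of_nonpos (not_le.1 hneg).le
      linarith
    have hx2 : x ^ 2 ≤ u₁ := by
      rw [← Real.sq_sqrt hu0]
      exact pow_le_pow_left₀ (ha.trans hx.1) (hx.2.trans hcp) 2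
    rw [hu₁, le_div_iff₀ hδ3] at hx2
    linarith
  have h₃ : ‖∫ x in c₂..b, cubicPhase y (δ ^ 3) x‖ ≤ 4 / δ := by
    rcases hc₂b.eq_or_lt with h | h
    · rw [h, integral_same, norm_zero]; positivity
    apply norm_integral_cubicPhase_le_of_deriv (by positivity) hδ
      (ha.trans (hac₁.trans hc₁₂)) hc₂b
    left
    intro x hx
    have hpc : p₂ ≤ c₂ := by
      have hmin := lt_of_le_of_lt (le_max_right a (min b p₂)) h
      rcases min_lt_iff.1 hmin with h' | h'
      · exact absurd h' (lt_irrefl _)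
      · exact le_max_of_le_right (le_min h'.le le_rfl)
    have hx2 : u₂ ≤ x ^ 2 := by
      rcases le_total 0 u₂ with h' | h'
      · rw [← Real.sq_sqrt h']
        exact pow_le_pow_left₀ hp₂ (hpc.trans hx.1) 2
      · exact h'.trans (sq_nonneg _)
    rw [hu₂, div_le_iff₀ hδ3] at hx2
    linarith
  have h₂ : ‖∫ x in c₁..c₂, cubicPhase y (δ ^ 3) x‖ ≤ 1 / δ := by
    have := norm_integral_le_of_norm_le_const (a := c₁) (b := c₂) (C := 1)
      (f := cubicPhase y (δ ^ 3)) fun x _ => (norm_cubicPhase _ _ _).le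
    refine this.trans ?_
    rw [one_mul, abs_of_nonneg (by linarith)]
    refine le_trans ?_ hlen
    have hmm : min b p₂ ≤ min b p₁ + (p₂ - p₁) := by
      rcases le_total b p₁ with h | h
      · rw [min_eq_left h, min_eq_left (h.trans hp)]; linarith
      · rw [min_eq_right h]; have := min_le_right b p₂; linarith
    have : c₂ ≤ c₁ + (p₂ - p₁) := by
      apply max_le
      · linarith
      · have := le_max_right a (min b p₁); linarith
    linarith
  have e : 9 / δ = 4 / δ + (1 / δ + 4 / δ) := by ring
  rw [e]
  exact (norm_add_le _ _).trans (add_le_add h₁ ((norm_add_le _ _).trans (add_le_add h₂ h₃)))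

theorem conj_cubicPhase (y τ ξ : ℝ) :
    (starRingEnd ℂ) (cubicPhase y τ ξ) = cubicPhase (-y) (-τ) ξ := by
  unfold cubicPhase
  rw [← exp_conj, map_mul, conj_ofReal, conj_I]
  congr 1; push_cast; ring

theorem cubicPhase_neg (y τ ξ : ℝ) : cubicPhase y τ (-ξ) = cubicPhase (-y) (-τ) ξ := by
  unfold cubicPhase
  congr 1; push_cast; ring

theorem norm_integral_gaussian_mul_cubicPhase_le {y δ μ r a b : ℝ} (hδ : 0 < δ) (ha : 0 ≤ a)
    (hab : a ≤ b) (hμ : ∀ x ∈ Icc a b, 0 ≤ μ * (x ^ 2 - r ^ 2)) :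
    ‖∫ x in a..b, (Real.exp (-(μ * (x ^ 2 - r ^ 2))) : ℂ) * cubicPhase y (δ ^ 3) x‖ ≤
      36 / δ := by
  have key := norm_integral_monotone_mul_deriv_le (a := a) (b := b)
    (A := fun x => Real.exp (-(μ * (x ^ 2 - r ^ 2))))
    (A' := fun x => Real.exp (-(μ * (x ^ 2 - r ^ 2))) * (-(2 * μ * x)))
    (G := fun x => ∫ s in a..x, cubicPhase y (δ ^ 3) s)
    (G' := cubicPhase y (δ ^ 3)) (M := 1) (C := 9 / δ) hab ?_ ?_ ?_ ?_ ?_ ?_ ?_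
  · refine key.trans (le_of_eq ?_); ring
  · intro x _
    apply HasDerivAt.exp
    have := (((hasDerivAt_pow 2 x).sub_const (r ^ 2)).const_mul μ).neg
    refine this.congr_deriv ?_
    push_cast; ring
  · intro x _
    exact ((continuous_cubicPhase y (δ ^ 3)).integral_hasStrictDerivAt a x).hasDerivAt
  · fun_prop
  · exact (continuous_cubicPhase _ _).continuousOn
  · rcases le_total 0 μ with h | h
    · right; intro x hx
      have : 0 ≤ x := ha.trans hx.1
      have h2 : 0 ≤ 2 * μ * x := by positivity
      exact mul_nonpos_of_nonneg_of_nonpos (Real.exp_pos _).le (by linarith)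
    · left; intro x hx
      have : 0 ≤ x := ha.trans hx.1
      have h2 : 0 ≤ 2 * (-μ) * x := mul_nonneg (by linarith) this
      exact mul_nonneg (Real.exp_pos _).le (by linarith)
  · intro x hx
    rw [abs_of_pos (Real.exp_pos _), Real.exp_le_one_iff]
    have := hμ x hx
    linarith
  · intro x hx
    exact norm_integral_cubicPhase_le hδ ha hx.1

end VanDerCorput

section Kernel
open Set Complex Filter Topology

/-- The even amplitude `exp (-μ (ω² - r²))`, cut off to the region where it is less than one. -/
noncomputable def gaussAmp (μ r ω : ℝ) : ℝ :=
  if 0 < μ * (ω ^ 2 - r ^ 2) then Real.exp (-(μ * (ω ^ 2 - r ^ 2))) else 0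

theorem gaussAmp_neg (μ r ω : ℝ) : gaussAmp μ r (-ω) = gaussAmp μ r ω := by
  simp [gaussAmp]

theorem gaussAmp_nonneg (μ r ω : ℝ) : 0 ≤ gaussAmp μ r ω := by
  unfold gaussAmp; split_ifs <;> positivity

theorem gaussAmp_le_one (μ r ω : ℝ) : gaussAmp μ r ω ≤ 1 := by
  unfold gaussAmp
  split_ifs with h
  · rw [Real.exp_le_one_iff]; linarith
  · exact zero_le_one

theorem measurable_gaussAmp : Measurable fun p : ℝ × ℝ × ℝ => gaussAmp p.1 p.2.1 p.2.2 := by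
  unfold gaussAmp
  exact Measurable.ite (measurableSet_lt (by fun_prop) (by fun_prop)) (by fun_prop) (by fun_prop)

theorem gaussAmp_le_exp (μ r ω : ℝ) :
    gaussAmp μ r ω ≤ Real.exp (|μ| * r ^ 2) * Real.exp (-|μ| * ω ^ 2) := by
  rw [← Real.exp_add]
  unfold gaussAmp
  split_ifs with h
  · apply Real.exp_le_exp.2
    rcases abs_cases μ with ⟨e, h0⟩ | ⟨e, h0⟩
    · rw [e]; linarith
    · rw [e]; nlinarith
  · positivity

theorem integrable_gaussAmp {μ : ℝ} (hμ : μ ≠ 0) (r : ℝ) : Integrable (gaussAmp μ r) := by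
  refine ((integrable_exp_neg_mul_sq (abs_pos.2 hμ)).const_mul (Real.exp (|μ| * r ^ 2))).mono'
    (measurable_gaussAmp.comp
      (by fun_prop : Measurable fun ω : ℝ => (μ, r, ω))).aestronglyMeasurable
    (Eventually.of_forall fun ω => ?_)
  rw [Real.norm_of_nonneg (gaussAmp_nonneg _ _ _)]
  exact gaussAmp_le_exp μ r ω

theorem integrable_gaussAmp_mul_cubicPhase {μ : ℝ} (hμ : μ ≠ 0) (r y τ : ℝ) :
    Integrable fun ω => (gaussAmp μ r ω : ℂ) * cubicPhase y τ ω := by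
  refine (integrable_gaussAmp hμ r).ofReal.mul_bdd (c := 1)
    (continuous_cubicPhase y τ).aestronglyMeasurable
    (Eventually.of_forall fun ω => (norm_cubicPhase _ _ _).le)

theorem norm_integral_Ioi_gaussAmp_le {μ r : ℝ} (hμ : μ ≠ 0) (hr : 0 ≤ r) (y : ℝ) {δ : ℝ}
    (hδ : 0 < δ) :
    ‖∫ ω in Ioi 0, (gaussAmp μ r ω : ℂ) * cubicPhase y (δ ^ 3) ω‖ ≤ 36 / δ := by
  set f : ℝ → ℂ := fun ω => (gaussAmp μ r ω : ℂ) * cubicPhase y (δ ^ 3) ω with hf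
  set g : ℝ → ℂ := fun x => (Real.exp (-(μ * (x ^ 2 - r ^ 2))) : ℂ) * cubicPhase y (δ ^ 3) x with hg
  have hfi : Integrable f := integrable_gaussAmp_mul_cubicPhase hμ r y _
  rcases hμ.lt_or_gt with h | h
  · have e : ∫ ω in Ioi 0, f ω = ∫ ω in Ioo 0 r, g ω := by
      rw [← integral_indicator measurableSet_Ioi, ← integral_indicator measurableSet_Ioo]
      congr 1
      ext ω
      by_cases h0 : 0 < ω
      · by_cases h1 : ω < r
        · have : 0 < μ * (ω ^ 2 - r ^ 2) :=
            mul_pos_of_neg_of_neg h (by nlinarith)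
          simp [indicator, h0, h1, hf, hg, gaussAmp, this]
        · have : ¬ 0 < μ * (ω ^ 2 - r ^ 2) := by
            apply not_lt.2
            apply mul_nonpos_of_nonpos_of_nonneg h.le (by nlinarith)
          simp [indicator, h0, h1, hf, gaussAmp, this]
      · simp [indicator, h0]
    rw [e, ← integral_Ioc_eq_integral_Ioo, ← intervalIntegral.integral_of_le hr]
    apply norm_integral_gaussian_mul_cubicPhase_le hδ le_rfl hr
    intro x hx
    exact mul_nonneg_of_nonpos_of_nonpos h.le (by have := hx.1; have := hx.2; nlinarith)
  · have hs : EqOn f g (Ioi r) := by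
      intro ω hω
      have : 0 < μ * (ω ^ 2 - r ^ 2) := mul_pos h (by have : r < ω := hω; nlinarith)
      simp [hf, hg, gaussAmp, this]
    have e : ∫ ω in Ioi 0, f ω = ∫ ω in Ioi r, g ω := by
      rw [← setIntegral_congr_fun measurableSet_Ioi hs]
      rw [← integral_indicator measurableSet_Ioi, ← integral_indicator measurableSet_Ioi]
      congr 1
      ext ω
      by_cases h1 : r < ω
      · simp [indicator, h1, hr.trans_lt h1]
      · by_cases h0 : 0 < ω
        · have : ¬ 0 < μ * (ω ^ 2 - r ^ 2) := by
            apply not_lt.2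
            apply mul_nonpos_of_nonneg_of_nonpos h.le (by nlinarith)
          simp [indicator, h0, h1, hf, gaussAmp, this]
        · simp [indicator, h0, h1]
    rw [e]
    have hgi : IntegrableOn g (Ioi r) :=
      (integrableOn_congr_fun hs measurableSet_Ioi).1 hfi.integrableOn
    have hlim := (intervalIntegral_tendsto_integral_Ioi r hgi tendsto_id).norm
    refine le_of_tendsto hlim ?_
    filter_upwards [eventually_ge_atTop r] with R hR
    apply norm_integral_gaussian_mul_cubicPhase_le hδ hr hR
    intro x hx
    exact mul_nonneg h.le (by have := hx.1; nlinarith)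

theorem norm_integral_Ioi_gaussAmp_le' {μ r : ℝ} (hμ : μ ≠ 0) (hr : 0 ≤ r) (y : ℝ) {τ δ : ℝ}
    (hδ : 0 < δ) (hτ : |τ| = δ ^ 3) :
    ‖∫ ω in Ioi 0, (gaussAmp μ r ω : ℂ) * cubicPhase y τ ω‖ ≤ 36 / δ := by
  rcases abs_cases τ with ⟨e, _⟩ | ⟨e, _⟩
  · rw [← e, hτ]
    exact norm_integral_Ioi_gaussAmp_le hμ hr y hδ
  · have hc : ∫ ω in Ioi 0, (gaussAmp μ r ω : ℂ) * cubicPhase y τ ω =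
        (starRingEnd ℂ) (∫ ω in Ioi 0, (gaussAmp μ r ω : ℂ) * cubicPhase (-y) (δ ^ 3) ω) := by
      rw [← integral_conj]
      congr 1
      ext ω
      rw [map_mul, conj_ofReal, conj_cubicPhase, neg_neg, ← hτ, e, neg_neg]
    rw [hc, RCLike.norm_conj]
    exact norm_integral_Ioi_gaussAmp_le hμ hr (-y) hδ

/-- Van der Corput bound for the kernel of the conjugated Airy propagator. -/
theorem norm_integral_gaussAmp_le {μ r : ℝ} (hμ : μ ≠ 0) (hr : 0 ≤ r) (y : ℝ) {τ δ : ℝ}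
    (hδ : 0 < δ) (hτ : |τ| = δ ^ 3) :
    ‖∫ ω, (gaussAmp μ r ω : ℂ) * cubicPhase y τ ω‖ ≤ 72 / δ := by
  have hi := integrable_gaussAmp_mul_cubicPhase hμ r y τ
  rw [← intervalIntegral.integral_Iic_add_Ioi (b := 0) hi.integrableOn hi.integrableOn]
  have e : ∫ ω in Iic 0, (gaussAmp μ r ω : ℂ) * cubicPhase y τ ω =
      ∫ ω in Ioi 0, (gaussAmp μ r ω : ℂ) * cubicPhase (-y) (-τ) ω := by
    have := integral_comp_neg_Ioi (0 : ℝ) (fun ω => (gaussAmp μ r ω : ℂ) * cubicPhase y τ ω)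
    rw [neg_zero] at this
    rw [← this]
    simp_rw [gaussAmp_neg, cubicPhase_neg]
  rw [e]
  refine (norm_add_le _ _).trans ?_
  have h1 := norm_integral_Ioi_gaussAmp_le' hμ hr (-y) hδ ((abs_neg τ).trans hτ)
  have h2 := norm_integral_Ioi_gaussAmp_le' hμ hr y hδ hτ
  calc _ ≤ 36 / δ + 36 / δ := add_le_add h1 h2
    _ = _ := by ring

end Kernel

section RealInterpolation
open Set ENNReal

theorem lintegral_Ioc_pow (c : ℝ) (hc : 0 ≤ c) (n : ℕ) :
    ∫⁻ t in Ioc 0 c, ENNReal.ofReal (t ^ n) = ENNReal.ofReal (c ^ (n + 1) / (n + 1)) := by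
  rw [← ofReal_integral_eq_lintegral_ofReal]
  · rw [← intervalIntegral.integral_of_le hc, integral_pow]; simp
  · exact ((continuous_pow n).integrableOn_Icc).mono_set Ioc_subset_Icc_self
  · filter_upwards [ae_restrict_mem measurableSet_Ioc] with t ht
    exact pow_nonneg ht.1.le _

theorem lintegral_ofReal_pow_eight_eq {X : Type*} [MeasurableSpace X] {μ : Measure X}
    {f : X → ℝ} (hf : Measurable f) (hf0 : ∀ x, 0 ≤ f x) :
    ∫⁻ x, ENNReal.ofReal (f x) ^ 8 ∂μ =
      8 * ∫⁻ t in Ioi (0 : ℝ), μ {x | t < f x} * ENNReal.ofReal (t ^ 7) := by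
  have := lintegral_rpow_eq_lintegral_meas_lt_mul μ (f := f) (Filter.Eventually.of_forall hf0)
    hf.aemeasurable (p := (8 : ℕ)) (by norm_num)
  have e7 : (((8 : ℕ) : ℝ) - 1) = ((7 : ℕ) : ℝ) := by norm_num
  simp_rw [e7, Real.rpow_natCast] at this
  simp_rw [← ENNReal.ofReal_pow (hf0 _), this]
  simp

/-- Marcinkiewicz interpolation between `L¹ → L^∞` (with constant `A`) and `L² → L²`
(with constant `1`), at the exponents `8/7` and `8`. The input is `v ^ 7` and the output is `F`. -/
theorem lintegral_pow_eight_le_of_endpoints {X : Type*} [MeasurableSpace X] {μ : Measure X}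
    [SFinite μ] {F : X → ℂ} {v : X → ℝ} (hF : Measurable F) (hv : Measurable v)
    (hv0 : ∀ x, 0 ≤ v x) {A N : ℝ} (hA : 0 < A) (hN : 0 < N)
    (hvN : ∫⁻ x, ENNReal.ofReal (v x ^ 8) ∂μ = ENNReal.ofReal N)
    (hsplit : ∀ k > 0, ∃ F₁ F₂ : X → ℂ, (∀ x, F x = F₁ x + F₂ x) ∧ Measurable F₂ ∧
      (∀ x, ‖F₁ x‖ₑ ≤ ENNReal.ofReal A * ∫⁻ x in {x | k < v x}, ENNReal.ofReal (v x ^ 7) ∂μ) ∧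
      ∫⁻ x, ‖F₂ x‖ₑ ^ 2 ∂μ ≤ ∫⁻ x in {x | v x ≤ k}, ENNReal.ofReal (v x ^ 14) ∂μ) :
    ∫⁻ x, ‖F x‖ₑ ^ 8 ∂μ ≤ ENNReal.ofReal (400 * A ^ 6 * N ^ 7) := by
  have hAN : 0 < A * N := mul_pos hA hN
  have level : ∀ t ∈ Ioi (0 : ℝ), μ {x | t < ‖F x‖} * ENNReal.ofReal (t ^ 7) ≤
      ∫⁻ x, {p : X × ℝ | v p.1 * p.2 ≤ 2 * (A * N)}.indicator
        (fun p => ENNReal.ofReal (4 * p.2 ^ 5 * v p.1 ^ 14)) (x, t) ∂μ := by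
    intro t ht
    have ht : 0 < t := ht
    set k := 2 * (A * N) / t with hk
    have hk0 : 0 < k := by positivity
    obtain ⟨F₁, F₂, hadd, hF₂, h₁, h₂⟩ := hsplit k hk0
    have hL1 : ∫⁻ x in {x | k < v x}, ENNReal.ofReal (v x ^ 7) ∂μ ≤ ENNReal.ofReal (N / k) := by
      have hm : MeasurableSet {x | k < v x} := measurableSet_lt measurable_const hv
      calc _ ≤ ∫⁻ x in {x | k < v x}, ENNReal.ofReal k⁻¹ * ENNReal.ofReal (v x ^ 8) ∂μ := by
            refine setLIntegral_mono' hm fun x hx => ?_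
            have hx : k < v x := hx
            rw [← ENNReal.ofReal_mul (by positivity)]
            apply ENNReal.ofReal_le_ofReal
            rw [inv_mul_eq_div, le_div_iff₀ hk0, pow_succ (v x) 7]
            exact mul_le_mul_of_nonneg_left hx.le (pow_nonneg (hv0 x) _)
        _ ≤ ∫⁻ x, ENNReal.ofReal k⁻¹ * ENNReal.ofReal (v x ^ 8) ∂μ := setLIntegral_le_lintegral _ _
        _ = _ := by
            rw [lintegral_const_mul _ (by fun_prop), hvN, ← ENNReal.ofReal_mul (by positivity)]
            congr 1; rw [inv_mul_eq_div]
    have hF₁ : ∀ x, ‖F₁ x‖ ≤ t / 2 := by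
      intro x
      have := (h₁ x).trans (mul_le_mul_right hL1 _)
      rw [← ENNReal.ofReal_mul hA.le, ← ofReal_norm, ENNReal.ofReal_le_ofReal_iff (by positivity)]
        at this
      refine this.trans (le_of_eq ?_)
      rw [hk]; field_simp
    have hsub : {x | t < ‖F x‖} ⊆ {x | ENNReal.ofReal (t ^ 2 / 4) ≤ ‖F₂ x‖ₑ ^ 2} := by
      intro x hx
      have hx : t < ‖F x‖ := hx
      have : t / 2 ≤ ‖F₂ x‖ := by
        have := norm_add_le (F₁ x) (F₂ x)
        rw [← hadd] at this
        linarith [hF₁ x]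
      change ENNReal.ofReal (t ^ 2 / 4) ≤ ‖F₂ x‖ₑ ^ 2
      rw [← ofReal_norm, ← ENNReal.ofReal_pow (norm_nonneg _)]
      apply ENNReal.ofReal_le_ofReal
      have := pow_le_pow_left₀ (by positivity) this 2
      linarith [this, (by ring : (t / 2) ^ 2 = t ^ 2 / 4)]
    have hmark : ENNReal.ofReal (t ^ 2 / 4) * μ {x | t < ‖F x‖} ≤
        ∫⁻ x in {x | v x ≤ k}, ENNReal.ofReal (v x ^ 14) ∂μ :=
      (mul_le_mul_right (measure_mono hsub) _).trans
        ((mul_meas_ge_le_lintegral (by fun_prop) _).trans h₂)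
    have e7 : ENNReal.ofReal (t ^ 7) = ENNReal.ofReal (4 * t ^ 5) * ENNReal.ofReal (t ^ 2 / 4) := by
      rw [← ENNReal.ofReal_mul (by positivity)]; congr 1; ring
    rw [e7, mul_comm, mul_assoc]
    refine (mul_le_mul_right hmark _).trans (le_of_eq ?_)
    rw [← lintegral_indicator (measurableSet_le hv measurable_const),
      ← lintegral_const_mul _ ((by fun_prop : Measurable _).indicator
        (measurableSet_le hv measurable_const))]
    congr 1
    ext x
    have hiff : v x ≤ k ↔ v x * t ≤ 2 * (A * N) := by rw [hk, le_div_iff₀ ht]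
    by_cases hx : v x ≤ k
    · rw [indicator_of_mem (s := {x | v x ≤ k}) hx,
        indicator_of_mem (s := {p : X × ℝ | v p.1 * p.2 ≤ 2 * (A * N)}) (hiff.1 hx),
        ← ENNReal.ofReal_mul (by positivity)]
    · rw [indicator_of_notMem (s := {x | v x ≤ k}) hx,
        indicator_of_notMem (s := {p : X × ℝ | v p.1 * p.2 ≤ 2 * (A * N)}) (mt hiff.2 hx), mul_zero]
  have hmeas : Measurable ({p : X × ℝ | v p.1 * p.2 ≤ 2 * (A * N)}.indicator
        (fun p => ENNReal.ofReal (4 * p.2 ^ 5 * v p.1 ^ 14))) := by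
    apply Measurable.indicator (by fun_prop)
    exact measurableSet_le (by fun_prop) measurable_const
  have inner : ∀ x, ∫⁻ t in Ioi (0 : ℝ), {p : X × ℝ | v p.1 * p.2 ≤ 2 * (A * N)}.indicator
        (fun p => ENNReal.ofReal (4 * p.2 ^ 5 * v p.1 ^ 14)) (x, t) ≤
      ENNReal.ofReal (50 * (A * N) ^ 6) * ENNReal.ofReal (v x ^ 8) := by
    intro x
    rcases (hv0 x).eq_or_lt with h0 | h0
    · simp [← h0, indicator]
    set c := 2 * (A * N) / v x with hc
    have hle : ∀ t ∈ Ioi (0 : ℝ), {p : X × ℝ | v p.1 * p.2 ≤ 2 * (A * N)}.indicator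
        (fun p => ENNReal.ofReal (4 * p.2 ^ 5 * v p.1 ^ 14)) (x, t) =
        (Ioc 0 c).indicator
          (fun t => ENNReal.ofReal (4 * v x ^ 14) * ENNReal.ofReal (t ^ 5)) t := by
      intro t ht
      have ht : 0 < t := ht
      have hiff : v x * t ≤ 2 * (A * N) ↔ t ≤ c := by rw [hc, le_div_iff₀ h0, mul_comm]
      by_cases hx : t ≤ c
      · rw [indicator_of_mem (s := Ioc 0 c) ⟨ht, hx⟩,
          indicator_of_mem (s := {p : X × ℝ | v p.1 * p.2 ≤ 2 * (A * N)}) (hiff.2 hx),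
          ← ENNReal.ofReal_mul (by positivity)]
        congr 1; ring
      · rw [indicator_of_notMem (s := Ioc 0 c) (fun h => hx h.2),
          indicator_of_notMem (s := {p : X × ℝ | v p.1 * p.2 ≤ 2 * (A * N)}) (mt hiff.1 hx)]
    rw [setLIntegral_congr_fun measurableSet_Ioi hle]
    refine (setLIntegral_le_lintegral _ _).trans ?_
    rw [lintegral_indicator measurableSet_Ioc, lintegral_const_mul _ (by fun_prop),
      lintegral_Ioc_pow c (by positivity), ← ENNReal.ofReal_mul (by positivity),
      ← ENNReal.ofReal_mul (by positivity)]
    apply ENNReal.ofReal_le_ofReal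
    have e : 4 * v x ^ 14 * (c ^ (5 + 1) / ((5 : ℕ) + 1)) = 128 / 3 * ((A * N) ^ 6 * v x ^ 8) := by
      rw [hc]; push_cast; field_simp; ring
    rw [e]
    have : 0 ≤ (A * N) ^ 6 * v x ^ 8 := by positivity
    linarith
  calc ∫⁻ x, ‖F x‖ₑ ^ 8 ∂μ = ∫⁻ x, ENNReal.ofReal ‖F x‖ ^ 8 ∂μ := by simp_rw [ofReal_norm]
    _ = 8 * ∫⁻ t in Ioi (0 : ℝ), μ {x | t < ‖F x‖} * ENNReal.ofReal (t ^ 7) :=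
        lintegral_ofReal_pow_eight_eq hF.norm fun _ => norm_nonneg _
    _ ≤ 8 * ∫⁻ x, ENNReal.ofReal (50 * (A * N) ^ 6) * ENNReal.ofReal (v x ^ 8) ∂μ := by
        gcongr 8 * ?_
        refine (setLIntegral_mono' measurableSet_Ioi level).trans ?_
        refine (lintegral_lintegral_swap (f := fun t x =>
          {p : X × ℝ | v p.1 * p.2 ≤ 2 * (A * N)}.indicator
          (fun p => ENNReal.ofReal (4 * p.2 ^ 5 * v p.1 ^ 14)) (x, t))
          (hmeas.comp measurable_swap).aemeasurable).trans_le ?_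
        exact lintegral_mono inner
    _ = ENNReal.ofReal (400 * A ^ 6 * N ^ 7) := by
        rw [lintegral_const_mul _ (by fun_prop), hvN, ← ENNReal.ofReal_mul (by positivity),
          show (8 : ℝ≥0∞) = ENNReal.ofReal 8 by simp, ← ENNReal.ofReal_mul (by norm_num)]
        congr 1; ring

end RealInterpolation

section FractionalIntegration
open Set ENNReal

theorem lintegral_even_eq {G : ℝ → ℝ≥0∞} (hG : ∀ s, G (-s) = G s) :
    ∫⁻ s, G s = 2 * ∫⁻ s in Ioi (0 : ℝ), G s := by
  have h : ∫⁻ s in Iic (0 : ℝ), G s = ∫⁻ s in Ioi (0 : ℝ), G s := by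
    have := (Measure.measurePreserving_neg (volume : Measure ℝ)).setLIntegral_comp_preimage_emb
      (MeasurableEquiv.neg ℝ).measurableEmbedding G (Iio 0)
    rw [setLIntegral_congr Iio_ae_eq_Iic.symm, ← this]
    simp [hG]
  rw [← lintegral_add_compl G (measurableSet_Iic (a := (0 : ℝ))), compl_Iic, h, two_mul]

noncomputable def rieszKernel (s : ℝ) : ℝ≥0∞ := ENNReal.ofReal (|s| ^ (-(1 / 4) : ℝ))

theorem rieszKernel_neg (s : ℝ) : rieszKernel (-s) = rieszKernel s := by simp [rieszKernel]

theorem measurable_rieszKernel : Measurable rieszKernel := by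
  unfold rieszKernel; fun_prop

theorem lintegral_rieszKernel_near {ς : ℝ} (hς : 0 < ς) :
    ∫⁻ s, {s : ℝ | |s| ≤ ς ^ 8}.indicator rieszKernel s = ENNReal.ofReal (8 / 3 * ς ^ 6) := by
  have hr : 0 < ς ^ 8 := by positivity
  rw [lintegral_even_eq fun s => by simp [indicator, rieszKernel_neg]]
  have h1 : ∀ s ∈ Ioi (0 : ℝ), {s : ℝ | |s| ≤ ς ^ 8}.indicator rieszKernel s =
      (Iic (ς ^ 8)).indicator (fun s => ENNReal.ofReal (s ^ (-(1 / 4) : ℝ))) s := by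
    intro s hs
    have hs : 0 < s := hs
    simp [indicator, rieszKernel, abs_of_pos hs]
  rw [setLIntegral_congr_fun measurableSet_Ioi h1, setLIntegral_indicator measurableSet_Iic,
    inter_comm, Ioi_inter_Iic, ← ofReal_integral_eq_lintegral_ofReal,
    ← intervalIntegral.integral_of_le hr.le, integral_rpow (by norm_num)]
  · rw [show (2 : ℝ≥0∞) = ENNReal.ofReal 2 by simp, ← ENNReal.ofReal_mul (by norm_num)]
    congr 1
    rw [← Real.rpow_natCast ς 8, ← Real.rpow_mul hς.le, ← Real.rpow_natCast ς 6]
    norm_num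
    ring
  · exact (intervalIntegral.intervalIntegrable_rpow' (by norm_num)).1
  · filter_upwards [ae_restrict_mem measurableSet_Ioc] with t ht
    exact Real.rpow_nonneg ht.1.le _

theorem lintegral_rieszKernel_far {r : ℝ} (hr : 0 < r) :
    ∫⁻ s, ({s : ℝ | |s| ≤ r}ᶜ.indicator rieszKernel s) ^ (8 : ℝ) = ENNReal.ofReal (2 / r) := by
  rw [lintegral_even_eq fun s => by simp [indicator, rieszKernel_neg]]
  have h1 : ∀ s ∈ Ioi (0 : ℝ), ({s : ℝ | |s| ≤ r}ᶜ.indicator rieszKernel s) ^ (8 : ℝ) =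
      (Ioi r).indicator (fun s => ENNReal.ofReal (s ^ (-2 : ℝ))) s := by
    intro s hs
    have hs : 0 < s := hs
    by_cases h : s ≤ r
    · simp [indicator, abs_of_pos hs, h]
    · have e : (s ^ (-(1 / 4) : ℝ)) ^ (8 : ℝ) = s ^ (-2 : ℝ) := by
        rw [← Real.rpow_mul hs.le]; norm_num
      simp only [indicator, mem_compl_iff, mem_ofPred_eq, abs_of_pos hs, h, not_false_iff, if_true,
        rieszKernel, mem_Ioi, lt_of_not_ge h]
      rw [ENNReal.ofReal_rpow_of_nonneg (by positivity) (by norm_num), e]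
  rw [setLIntegral_congr_fun measurableSet_Ioi h1, setLIntegral_indicator measurableSet_Ioi,
    inter_eq_self_of_subset_left (Ioi_subset_Ioi hr.le), ← ofReal_integral_eq_lintegral_ofReal,
    integral_Ioi_rpow_of_lt (by norm_num) hr]
  · rw [show (2 : ℝ≥0∞) = ENNReal.ofReal 2 by simp, ← ENNReal.ofReal_mul (by norm_num)]
    congr 1
    norm_num [Real.rpow_neg_one]
    ring
  · exact integrableOn_Ioi_rpow_of_lt (by norm_num) hr
  · filter_upwards [ae_restrict_mem measurableSet_Ioi] with t ht
    exact Real.rpow_nonneg (hr.trans ht).le _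

/-- Hardy-Littlewood-Sobolev inequality on the line for the kernel `|s| ^ (-1/4)`, at the
exponents `8/7` and `8`. The input is `v ^ 7`. -/
theorem lintegral_pow_eight_le_of_le_rieszKernel {f v : ℝ → ℝ} (hf : Measurable f)
    (hf0 : ∀ t, 0 ≤ f t) (hv : Measurable v) (hv0 : ∀ s, 0 ≤ v s) {m : ℝ} (hm : 0 < m)
    (hvm : ∫⁻ s, ENNReal.ofReal (v s ^ 8) = ENNReal.ofReal (m ^ 8))
    (hfv : ∀ t, ENNReal.ofReal (f t) ≤
      ∫⁻ s, rieszKernel (t - s) * ENNReal.ofReal (v s ^ 7)) :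
    ∫⁻ t, ENNReal.ofReal (f t) ^ 8 ≤ ENNReal.ofReal (2 * 10 ^ 8 * m ^ 56) := by
  have level : ∀ α ∈ Ioi (0 : ℝ), volume {t | α < f t} * ENNReal.ofReal (α ^ 7) ≤
      ∫⁻ s, {p : ℝ × ℝ | p.2 < 16 * m ^ 6 * v p.1}.indicator
        (fun p => ENNReal.ofReal (16 / 3 * 8 ^ 6 * m ^ 42 * v p.1 ^ 7)) (s, α) := by
    intro α hα
    have hα : 0 < α := hα
    set ς := 8 * m ^ 7 / α with hς
    have hς0 : 0 < ς := by positivity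
    set k := α / (16 * m ^ 6) with hk
    have hk0 : 0 < k := by positivity
    set S : Set ℝ := {s : ℝ | |s| ≤ ς ^ 8} with hS
    have hSm : MeasurableSet S := measurableSet_le (by fun_prop) measurable_const
    have hmk : MeasurableSet {s | v s ≤ k} := measurableSet_le hv measurable_const
    have hn : Measurable (S.indicator rieszKernel) := measurable_rieszKernel.indicator hSm
    have hfm : Measurable (Sᶜ.indicator rieszKernel) := measurable_rieszKernel.indicator hSm.compl
    set w : ℝ → ℝ≥0∞ := fun s => ENNReal.ofReal (v s ^ 7) with hw
    have hwm : Measurable w := by fun_prop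
    set w₁ := {s | v s ≤ k}.indicator w with hw₁
    set w₂ := {s | v s ≤ k}ᶜ.indicator w with hw₂
    have hw₁m : Measurable w₁ := hwm.indicator hmk
    have hw₂m : Measurable w₂ := hwm.indicator hmk.compl
    have far : ∀ t, ∫⁻ s, Sᶜ.indicator rieszKernel (t - s) * w s ≤ ENNReal.ofReal (α / 4) := by
      intro t
      have hh := ENNReal.lintegral_mul_le_Lp_mul_Lq volume
        ((Real.holderConjugate_iff (p := 8) (q := 8 / 7)).2 ⟨by norm_num, by norm_num⟩)
        (f := fun s => Sᶜ.indicator rieszKernel (t - s)) (g := w)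
        (hfm.comp (by fun_prop)).aemeasurable hwm.aemeasurable
      refine hh.trans ?_
      rw [lintegral_sub_left_eq_self (fun s => (Sᶜ.indicator rieszKernel s) ^ (8 : ℝ)) t,
        lintegral_rieszKernel_far (by positivity)]
      have ew : ∀ s, w s ^ (8 / 7 : ℝ) = ENNReal.ofReal (v s ^ 8) := by
        intro s
        rw [hw]
        dsimp only
        rw [ENNReal.ofReal_rpow_of_nonneg (pow_nonneg (hv0 s) _) (by norm_num),
          ← Real.rpow_natCast, ← Real.rpow_mul (hv0 s), ← Real.rpow_natCast]
        norm_num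
      simp_rw [ew, hvm]
      rw [ENNReal.ofReal_rpow_of_nonneg (by positivity) (by norm_num),
        ENNReal.ofReal_rpow_of_nonneg (by positivity) (by norm_num),
        ← ENNReal.ofReal_mul (by positivity)]
      apply ENNReal.ofReal_le_ofReal
      have e1 : (m ^ 8) ^ (1 / (8 / 7) : ℝ) = m ^ 7 := by
        rw [← Real.rpow_natCast, ← Real.rpow_mul hm.le, ← Real.rpow_natCast]; norm_num
      have e2 : (2 / ς ^ 8) ^ (1 / 8 : ℝ) ≤ 2 / ς := by
        have : 2 / ς ^ 8 ≤ (2 / ς) ^ 8 := by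
          rw [div_pow 2 ς 8]
          exact div_le_div_of_nonneg_right (by norm_num) (by positivity)
        calc _ ≤ ((2 / ς) ^ 8) ^ (1 / 8 : ℝ) := by gcongr
          _ = 2 / ς := by
            rw [← Real.rpow_natCast, ← Real.rpow_mul (by positivity)]; norm_num
      rw [e1]
      calc _ ≤ 2 / ς * m ^ 7 := by gcongr
        _ = α / 4 := by rw [hς]; field_simp; ring
    have near : ∀ t, ∫⁻ s, S.indicator rieszKernel (t - s) * w₁ s ≤ ENNReal.ofReal (α / 4) := by
      intro t
      calc _ ≤ ∫⁻ s, S.indicator rieszKernel (t - s) * ENNReal.ofReal (k ^ 7) := by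
            gcongr with s
            by_cases h : v s ≤ k
            · rw [hw₁, indicator_of_mem (s := {s | v s ≤ k}) h]
              exact ENNReal.ofReal_le_ofReal (pow_le_pow_left₀ (hv0 s) h _)
            · rw [hw₁, indicator_of_notMem (s := {s | v s ≤ k}) h]; exact zero_le
        _ = ENNReal.ofReal (8 / 3 * ς ^ 6) * ENNReal.ofReal (k ^ 7) := by
            rw [lintegral_mul_const _ (show Measurable fun s => S.indicator rieszKernel (t - s) from
                hn.comp (by fun_prop)),
              lintegral_sub_left_eq_self (fun s => S.indicator rieszKernel s) t,
              lintegral_rieszKernel_near hς0]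
        _ ≤ _ := by
            rw [← ENNReal.ofReal_mul (by positivity)]
            apply ENNReal.ofReal_le_ofReal
            have : 8 / 3 * ς ^ 6 * k ^ 7 = 8 / 3 * 8 ^ 6 / 16 ^ 7 * α := by
              rw [hς, hk]; field_simp
            rw [this]; linarith
    have split : ∀ t, ∫⁻ s, rieszKernel (t - s) * w s =
        (∫⁻ s, Sᶜ.indicator rieszKernel (t - s) * w s) +
        ((∫⁻ s, S.indicator rieszKernel (t - s) * w₁ s) +
        ∫⁻ s, S.indicator rieszKernel (t - s) * w₂ s) := by
      intro t
      have hn' : Measurable fun s => S.indicator rieszKernel (t - s) := hn.comp (by fun_prop)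
      have hfm' : Measurable fun s => Sᶜ.indicator rieszKernel (t - s) := hfm.comp (by fun_prop)
      have hnw : Measurable fun s => S.indicator rieszKernel (t - s) * w₁ s := hn'.mul hw₁m
      have hfw : Measurable fun s => Sᶜ.indicator rieszKernel (t - s) * w s := hfm'.mul hwm
      rw [← lintegral_add_left hnw, ← lintegral_add_left hfw]
      congr 1; ext s
      have e1 : w₁ s + w₂ s = w s := indicator_self_add_compl_apply _ _ _
      have e2 : Sᶜ.indicator rieszKernel (t - s) + S.indicator rieszKernel (t - s) =
        rieszKernel (t - s) := indicator_compl_add_self_apply _ _ _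
      rw [← mul_add, e1, ← add_mul, e2]
    set G : ℝ → ℝ≥0∞ := fun t => ∫⁻ s, S.indicator rieszKernel (t - s) * w₂ s with hG
    have hprod : Measurable fun p : ℝ × ℝ => S.indicator rieszKernel (p.1 - p.2) * w₂ p.2 :=
      (hn.comp (by fun_prop)).mul (hw₂m.comp measurable_snd)
    have hsub : {t | α < f t} ⊆ {t | ENNReal.ofReal (α / 2) ≤ G t} := by
      intro t ht
      have ht : α < f t := ht
      change ENNReal.ofReal (α / 2) ≤ G t
      by_contra! hlt
      have h1 := (ENNReal.ofReal_le_ofReal ht.le).trans ((hfv t).trans_eq (split t))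
      have h2 : ENNReal.ofReal α = ENNReal.ofReal (α / 4) + (ENNReal.ofReal (α / 4) +
          ENNReal.ofReal (α / 2)) := by
        rw [← ENNReal.ofReal_add (by positivity) (by positivity),
          ← ENNReal.ofReal_add (by positivity) (by positivity)]
        congr 1; ring
      refine absurd h1 (not_le.2 ?_)
      rw [h2]
      refine ENNReal.add_lt_add_of_le_of_lt ?_ (far t)
        (ENNReal.add_lt_add_of_le_of_lt ?_ (near t) hlt)
      · exact ((far t).trans_lt ENNReal.ofReal_lt_top).ne
      · exact ((near t).trans_lt ENNReal.ofReal_lt_top).ne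
    have hGint : ∫⁻ t, G t = ENNReal.ofReal (8 / 3 * ς ^ 6) * ∫⁻ s, w₂ s := by
      rw [hG, lintegral_lintegral_swap hprod.aemeasurable, ← lintegral_const_mul _ hw₂m]
      congr 1; ext s
      rw [lintegral_mul_const _ (show Measurable fun t => S.indicator rieszKernel (t - s) from
          hn.comp (by fun_prop)),
        lintegral_sub_right_eq_self (fun t => S.indicator rieszKernel t) s,
        lintegral_rieszKernel_near hς0]
    have hmark : ENNReal.ofReal (α / 2) * volume {t | α < f t} ≤
        ENNReal.ofReal (8 / 3 * ς ^ 6) * ∫⁻ s, w₂ s :=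
      (mul_le_mul_right (measure_mono hsub) _).trans
        ((mul_meas_ge_le_lintegral hprod.lintegral_prod_right' _).trans_eq hGint)
    have e7 : ENNReal.ofReal (α ^ 7) = ENNReal.ofReal (2 * α ^ 6) * ENNReal.ofReal (α / 2) := by
      rw [← ENNReal.ofReal_mul (by positivity)]; congr 1; ring
    rw [e7, mul_comm, mul_assoc]
    refine (mul_le_mul_right hmark _).trans (le_of_eq ?_)
    rw [← mul_assoc, ← ENNReal.ofReal_mul (by positivity), ← lintegral_const_mul _ hw₂m]
    congr 1; ext s
    have hiff : α < 16 * m ^ 6 * v s ↔ ¬ v s ≤ k := by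
      rw [hk, not_le, div_lt_iff₀ (by positivity), mul_comm]
    by_cases h : v s ≤ k
    · rw [hw₂, indicator_of_notMem (s := {s | v s ≤ k}ᶜ) (fun hc => hc h),
        indicator_of_notMem (s := {p : ℝ × ℝ | p.2 < 16 * m ^ 6 * v p.1})
          (fun hc => hiff.1 hc h), mul_zero]
    · rw [hw₂, indicator_of_mem (s := {s | v s ≤ k}ᶜ) h,
        indicator_of_mem (s := {p : ℝ × ℝ | p.2 < 16 * m ^ 6 * v p.1}) (hiff.2 h), hw,
        ← ENNReal.ofReal_mul (by positivity)]
      congr 1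
      rw [hς]; field_simp; ring
  have hmeas : Measurable ({p : ℝ × ℝ | p.2 < 16 * m ^ 6 * v p.1}.indicator
        (fun p => ENNReal.ofReal (16 / 3 * 8 ^ 6 * m ^ 42 * v p.1 ^ 7))) := by
    apply Measurable.indicator (by fun_prop)
    exact measurableSet_lt measurable_snd (by fun_prop)
  have inner : ∀ s, ∫⁻ α in Ioi (0 : ℝ), {p : ℝ × ℝ | p.2 < 16 * m ^ 6 * v p.1}.indicator
        (fun p => ENNReal.ofReal (16 / 3 * 8 ^ 6 * m ^ 42 * v p.1 ^ 7)) (s, α) =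
      ENNReal.ofReal (16 / 3 * 8 ^ 6 * 16 * m ^ 48) * ENNReal.ofReal (v s ^ 8) := by
    intro s
    have h0 := hv0 s
    have : ∀ α, {p : ℝ × ℝ | p.2 < 16 * m ^ 6 * v p.1}.indicator
        (fun p => ENNReal.ofReal (16 / 3 * 8 ^ 6 * m ^ 42 * v p.1 ^ 7)) (s, α) =
        (Iio (16 * m ^ 6 * v s)).indicator
          (fun _ => ENNReal.ofReal (16 / 3 * 8 ^ 6 * m ^ 42 * v s ^ 7)) α := fun α => rfl
    simp_rw [this]
    rw [setLIntegral_indicator measurableSet_Iio, inter_comm, Ioi_inter_Iio, setLIntegral_const,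
      Real.volume_Ioo, ← ENNReal.ofReal_mul (by positivity), ← ENNReal.ofReal_mul (by positivity)]
    congr 1; ring
  calc ∫⁻ t, ENNReal.ofReal (f t) ^ 8
      = 8 * ∫⁻ α in Ioi (0 : ℝ), volume {t | α < f t} * ENNReal.ofReal (α ^ 7) :=
        lintegral_ofReal_pow_eight_eq hf hf0
    _ ≤ 8 * ∫⁻ s, ENNReal.ofReal (16 / 3 * 8 ^ 6 * 16 * m ^ 48) * ENNReal.ofReal (v s ^ 8) := by
        gcongr 8 * ?_
        refine (setLIntegral_mono' measurableSet_Ioi level).trans ?_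
        refine (lintegral_lintegral_swap (f := fun t x =>
          {p : ℝ × ℝ | p.2 < 16 * m ^ 6 * v p.1}.indicator
            (fun p => ENNReal.ofReal (16 / 3 * 8 ^ 6 * m ^ 42 * v p.1 ^ 7)) (x, t))
          (hmeas.comp measurable_swap).aemeasurable).trans_le ?_
        exact lintegral_mono fun s => (inner s).le
    _ ≤ ENNReal.ofReal (2 * 10 ^ 8 * m ^ 56) := by
        rw [lintegral_const_mul _ (by fun_prop), hvm, ← ENNReal.ofReal_mul (by positivity),
          show (8 : ℝ≥0∞) = ENNReal.ofReal 8 by simp, ← ENNReal.ofReal_mul (by norm_num)]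
        apply ENNReal.ofReal_le_ofReal
        have : 0 ≤ m ^ 56 := by positivity
        nlinarith [(by ring : m ^ 48 * m ^ 8 = m ^ 56)]

end FractionalIntegration

section Multiplier
open Set ENNReal FourierTransform

/-- The Fourier multiplier operator with symbol `σ`. -/
noncomputable def fourierMul (σ w : ℝ → ℂ) : ℝ → ℂ := 𝓕⁻ fun ξ => σ ξ * 𝓕 w ξ

theorem norm_fourier_le (w : ℝ → ℂ) (ξ : ℝ) : ‖𝓕 w ξ‖ ≤ ∫ y, ‖w y‖ := by
  rw [Real.fourier_eq]
  refine (norm_integral_le_integral_norm _).trans (le_of_eq ?_)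
  simp_rw [Circle.norm_smul]

theorem integrable_mul_fourier {σ w : ℝ → ℂ} (hσ : Integrable σ) (hw : Integrable w) :
    Integrable fun ξ => σ ξ * 𝓕 w ξ :=
  hσ.mul_bdd (c := ∫ y, ‖w y‖) (continuous_fourier_of_integrable hw).aestronglyMeasurable
    (Filter.Eventually.of_forall fun ξ => norm_fourier_le w ξ)

theorem continuous_fourierInv_of_integrable {f : ℝ → ℂ} (hf : Integrable f) :
    Continuous (𝓕⁻ f) := by
  rw [Real.fourierInv_eq_fourier_comp_neg]
  exact continuous_fourier_of_integrable hf.comp_neg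

theorem continuous_fourierMul {σ w : ℝ → ℂ} (hσ : Integrable σ) (hw : Integrable w) :
    Continuous (fourierMul σ w) :=
  continuous_fourierInv_of_integrable (integrable_mul_fourier hσ hw)

theorem enorm_fourierMul_le {σ w : ℝ → ℂ} (hσ : Integrable σ) (hw : Integrable w) {A : ℝ}
    (hA : ∀ y, ‖𝓕⁻ σ y‖ ≤ A) (x : ℝ) :
    ‖fourierMul σ w x‖ₑ ≤ ENNReal.ofReal A * ∫⁻ y, ‖w y‖ₑ := by
  have hA0 : 0 ≤ A := (norm_nonneg _).trans (hA 0)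
  set G : ℝ → ℂ := fun ξ => Real.fourierChar (ξ * x) • σ ξ with hG
  have hGi : Integrable G := by
    have := (Real.fourierIntegral_convergent_iff (μ := volume) (f := σ) (-x)).2 hσ
    simpa [hG, mul_comm] using this
  have h1 := VectorFourier.integral_fourierIntegral_smul_eq_flip (L := innerₗ ℝ)
    Real.continuous_fourierChar continuous_inner (μ := volume) (ν := volume) hw hGi
  have h2 : fourierMul σ w x = ∫ y, w y • 𝓕 G y := by
    rw [fourierMul, Real.fourierInv_eq]
    refine Eq.trans ?_ (h1.trans ?_)
    · congr 1; ext ξ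
      change _ = 𝓕 w ξ • G ξ
      have e : inner ℝ ξ x = ξ * x := by simp [mul_comm]
      simp only [hG, Circle.smul_def, smul_eq_mul, e]
      ring
    · congr 1; ext y
      simp [Real.fourier_eq, VectorFourier.fourierIntegral]
  have h3 : ∀ y, 𝓕 G y = 𝓕⁻ σ (x - y) := by
    intro y
    rw [Real.fourier_eq, Real.fourierInv_eq]
    congr 1; ext ξ
    rw [hG]
    dsimp only
    rw [← mul_smul, ← AddChar.map_add_eq_mul]
    congr 2
    simp; ring
  rw [h2, ← lintegral_const_mul' _ _ ENNReal.ofReal_ne_top]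
  refine (enorm_integral_le_lintegral_enorm _).trans (lintegral_mono fun y => ?_)
  rw [enorm_smul, mul_comm, h3, ← ofReal_norm (𝓕⁻ σ _)]
  gcongr
  exact hA _

theorem eLpNorm_fourierMul_le {σ w : ℝ → ℂ} (hσ : Integrable σ) (hσ1 : ∀ ξ, ‖σ ξ‖ ≤ 1)
    (hw : Integrable w) (hw2 : MemLp w 2) :
    eLpNorm (fourierMul σ w) 2 ≤ eLpNorm w 2 := by
  have hle : eLpNorm (fun ξ => σ ξ * 𝓕 w ξ) 2 volume ≤ eLpNorm w 2 volume := by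
    rw [← eLpNorm_fourier_of_integrable hw hw2]
    refine eLpNorm_mono fun ξ => ?_
    rw [norm_mul]
    exact mul_le_of_le_one_left (norm_nonneg _) (hσ1 ξ)
  have hi := integrable_mul_fourier hσ hw
  rw [fourierMul, eLpNorm_fourierInv_of_integrable hi
    ⟨hi.aestronglyMeasurable, hle.trans_lt hw2.eLpNorm_lt_top⟩]
  exact hle

theorem fourierMul_add {σ w₁ w₂ : ℝ → ℂ} (hσ : Integrable σ) (h₁ : Integrable w₁)
    (h₂ : Integrable w₂) (x : ℝ) :
    fourierMul σ (fun y => w₁ y + w₂ y) x = fourierMul σ w₁ x + fourierMul σ w₂ x := by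
  have e : ∀ ξ, 𝓕 (fun y => w₁ y + w₂ y) ξ = 𝓕 w₁ ξ + 𝓕 w₂ ξ := by
    intro ξ
    simp only [Real.fourier_eq, smul_add]
    exact integral_add ((Real.fourierIntegral_convergent_iff ξ).2 h₁)
      ((Real.fourierIntegral_convergent_iff ξ).2 h₂)
  unfold fourierMul
  simp only [e, mul_add, Real.fourierInv_eq_fourier_neg, Real.fourier_eq, smul_add]
  exact integral_add
    ((Real.fourierIntegral_convergent_iff (-x)).2 (integrable_mul_fourier hσ h₁))
    ((Real.fourierIntegral_convergent_iff (-x)).2 (integrable_mul_fourier hσ h₂))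

theorem lintegral_enorm_sq_eq (f : ℝ → ℂ) :
    ∫⁻ x, ‖f x‖ₑ ^ 2 = eLpNorm f 2 volume ^ 2 := by
  have := eLpNorm_nnreal_pow_eq_lintegral (μ := (volume : Measure ℝ)) (f := f) (p := 2) (by simp)
  simpa using this.symm

theorem lintegral_fourierMul_pow_eight_le {σ w : ℝ → ℂ} (hσ : Integrable σ)
    (hσ1 : ∀ ξ, ‖σ ξ‖ ≤ 1) {A : ℝ} (hA0 : 0 < A) (hA : ∀ y, ‖𝓕⁻ σ y‖ ≤ A)
    (hwm : Measurable w) (hw : Integrable w) (hw2 : MemLp w 2) :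
    ∫⁻ x, ‖fourierMul σ w x‖ₑ ^ 8 ≤
      ENNReal.ofReal (400 * A ^ 6) * (∫⁻ y, ‖w y‖ₑ ^ (8 / 7 : ℝ)) ^ 7 := by
  set v : ℝ → ℝ := fun y => ‖w y‖ ^ (1 / 7 : ℝ) with hv
  have hv0 : ∀ y, 0 ≤ v y := fun y => by positivity
  have hvm : Measurable v := by fun_prop
  have hv7 : ∀ y, ENNReal.ofReal (v y ^ 7) = ‖w y‖ₑ := by
    intro y
    rw [← ofReal_norm, hv, ← Real.rpow_natCast, ← Real.rpow_mul (norm_nonneg _)]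
    norm_num
  have hv14 : ∀ y, ENNReal.ofReal (v y ^ 14) = ‖w y‖ₑ ^ 2 := by
    intro y
    rw [← hv7, ← ENNReal.ofReal_pow (by positivity)]; ring_nf
  have hv8 : ∀ y, ENNReal.ofReal (v y ^ 8) = ‖w y‖ₑ ^ (8 / 7 : ℝ) := by
    intro y
    rw [← ofReal_norm, hv, ENNReal.ofReal_rpow_of_nonneg (norm_nonneg _) (by norm_num),
      ← Real.rpow_natCast, ← Real.rpow_mul (norm_nonneg _)]
    norm_num
  set N := ∫⁻ y, ‖w y‖ₑ ^ (8 / 7 : ℝ) with hN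
  rcases eq_or_ne N ∞ with htop | htop
  · rw [htop, ENNReal.top_pow (by norm_num), ENNReal.mul_top (by positivity)]
    exact le_top
  rcases eq_or_ne N 0 with h0 | h0
  · have hw0 : ∫⁻ y, ‖w y‖ₑ = 0 := by
      rw [hN, lintegral_eq_zero_iff (by fun_prop)] at h0
      rw [lintegral_eq_zero_iff (by fun_prop)]
      filter_upwards [h0] with y hy
      simpa using hy
    have hz : ∀ x, ‖fourierMul σ w x‖ₑ = 0 := fun x => by
      have := enorm_fourierMul_le hσ hw hA x
      rw [hw0, mul_zero] at this
      exact le_antisymm this zero_le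
    simp [hz]
  have hNr : ENNReal.ofReal N.toReal = N := ENNReal.ofReal_toReal htop
  have hmk : ∀ k, MeasurableSet {y | v y ≤ k} := fun k => measurableSet_le hvm measurable_const
  have key := lintegral_pow_eight_le_of_endpoints (μ := (volume : Measure ℝ))
    (F := fourierMul σ w) (v := v) (continuous_fourierMul hσ hw).measurable hvm hv0 hA0
    (ENNReal.toReal_pos h0 htop) (N := N.toReal) (by simp_rw [hv8, hNr, hN]) fun k hk => by
      have h1 : Integrable ({y | v y ≤ k}ᶜ.indicator w) := hw.indicator (hmk k).compl
      have h2 : Integrable ({y | v y ≤ k}.indicator w) := hw.indicator (hmk k)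
      refine ⟨fourierMul σ ({y | v y ≤ k}ᶜ.indicator w), fourierMul σ ({y | v y ≤ k}.indicator w),
        fun x => ?_, (continuous_fourierMul hσ h2).measurable, fun x => ?_, ?_⟩
      · rw [← fourierMul_add hσ h1 h2]
        congr 1; ext y
        exact (indicator_compl_add_self_apply _ _ _).symm
      · refine (enorm_fourierMul_le hσ h1 hA x).trans (le_of_eq ?_)
        have e : {y | v y ≤ k}ᶜ = {y | k < v y} := by ext y; simp
        simp_rw [e, hv7, enorm_indicator_eq_indicator_enorm]
        rw [lintegral_indicator (measurableSet_lt measurable_const hvm)]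
      · rw [lintegral_enorm_sq_eq]
        calc _ ≤ eLpNorm ({y | v y ≤ k}.indicator w) 2 volume ^ 2 := by
              gcongr
              exact eLpNorm_fourierMul_le hσ hσ1 h2 (hw2.indicator (hmk k))
          _ = _ := by
              rw [← lintegral_enorm_sq_eq, ← lintegral_indicator (hmk k)]
              congr 1; ext y
              by_cases h : v y ≤ k
              · rw [indicator_of_mem (s := {y | v y ≤ k}) h,
                  indicator_of_mem (s := {y | v y ≤ k}) h, hv14]
              · rw [indicator_of_notMem (s := {y | v y ≤ k}) h,
                  indicator_of_notMem (s := {y | v y ≤ k}) h]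
                simp
  rw [ENNReal.ofReal_mul (by positivity), ENNReal.ofReal_pow ENNReal.toReal_nonneg, hNr] at key
  exact key

end Multiplier

section Airy
open Set ENNReal FourierTransform

/-- The symbol of the propagator of `∂ₜ + (∂ₓ - lam) ^ 3`, restricted to the frequencies where
it decays in the time direction `τ`. -/
noncomputable def airySymbol (lam τ ξ : ℝ) : ℂ :=
  (gaussAmp (3 * τ * lam) (|lam| / √3) (2 * Real.pi * ξ) : ℂ) *
    cubicPhase (-(3 * τ * lam ^ 2)) τ (2 * Real.pi * ξ)

noncomputable def airyExponent (lam ξ : ℝ) : ℂ := (2 * Real.pi * ξ : ℝ) * Complex.I - lam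

theorem airyExponent_pow_three_re (lam ξ : ℝ) :
    (airyExponent lam ξ ^ 3).re = lam * (3 * (2 * Real.pi * ξ) ^ 2 - lam ^ 2) := by
  simp only [airyExponent, pow_succ, pow_zero, one_mul, Complex.mul_re, Complex.mul_im,
    Complex.sub_re, Complex.sub_im, Complex.ofReal_re, Complex.ofReal_im, Complex.I_re,
    Complex.I_im]
  ring

theorem airyExponent_pow_three_im (lam ξ : ℝ) :
    (airyExponent lam ξ ^ 3).im =
      3 * (2 * Real.pi * ξ) * lam ^ 2 - (2 * Real.pi * ξ) ^ 3 := by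
  simp only [airyExponent, pow_succ, pow_zero, one_mul, Complex.mul_re, Complex.mul_im,
    Complex.sub_re, Complex.sub_im, Complex.ofReal_re, Complex.ofReal_im, Complex.I_re,
    Complex.I_im]
  ring

theorem airySymbol_eq (lam τ ξ : ℝ) :
    airySymbol lam τ ξ =
      if 0 < τ * (airyExponent lam ξ ^ 3).re then Complex.exp (-(τ * airyExponent lam ξ ^ 3))
      else 0 := by
  have h3 : (|lam| / √3) ^ 2 = lam ^ 2 / 3 := by
    rw [div_pow, Real.sq_sqrt (by norm_num), sq_abs]
  have hc : 3 * τ * lam * ((2 * Real.pi * ξ) ^ 2 - (|lam| / √3) ^ 2) =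
      τ * (airyExponent lam ξ ^ 3).re := by
    rw [h3, airyExponent_pow_three_re]; ring
  unfold airySymbol gaussAmp
  rw [hc]
  split_ifs with h
  · rw [cubicPhase, Complex.ofReal_exp, ← Complex.exp_add]
    congr 1
    conv_rhs => rw [← Complex.re_add_im (airyExponent lam ξ ^ 3), airyExponent_pow_three_im]
    push_cast
    ring
  · simp

theorem measurable_airySymbol (lam : ℝ) :
    Measurable fun p : ℝ × ℝ => airySymbol lam p.1 p.2 := by
  unfold airySymbol cubicPhase
  refine Measurable.mul (Complex.measurable_ofReal.comp (measurable_gaussAmp.comp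
    (by fun_prop : Measurable fun p : ℝ × ℝ =>
      (3 * p.1 * lam, |lam| / √3, 2 * Real.pi * p.2)))) (by fun_prop)

theorem norm_airySymbol (lam τ ξ : ℝ) :
    ‖airySymbol lam τ ξ‖ = gaussAmp (3 * τ * lam) (|lam| / √3) (2 * Real.pi * ξ) := by
  rw [airySymbol, norm_mul, norm_cubicPhase, mul_one, Complex.norm_real,
    Real.norm_of_nonneg (gaussAmp_nonneg _ _ _)]

theorem norm_airySymbol_le_one (lam τ ξ : ℝ) : ‖airySymbol lam τ ξ‖ ≤ 1 := by
  rw [norm_airySymbol]; exact gaussAmp_le_one _ _ _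

theorem integrable_airySymbol {lam τ : ℝ} (hlam : lam ≠ 0) (hτ : τ ≠ 0) :
    Integrable (airySymbol lam τ) :=
  (integrable_gaussAmp_mul_cubicPhase (μ := 3 * τ * lam) (by simp [hlam, hτ]) (|lam| / √3)
    (-(3 * τ * lam ^ 2)) τ).comp_mul_left' (by positivity)

theorem norm_fourierInv_airySymbol_le {lam τ δ : ℝ} (hlam : lam ≠ 0) (hδ : 0 < δ)
    (hτ : |τ| = δ ^ 3) (y : ℝ) : ‖𝓕⁻ (airySymbol lam τ) y‖ ≤ 12 / δ := by
  have hτ0 : τ ≠ 0 := by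
    intro h
    rw [h, abs_zero] at hτ
    exact (pow_pos hδ 3).ne hτ
  set H : ℝ → ℂ := fun ω => (gaussAmp (3 * τ * lam) (|lam| / √3) ω : ℂ) *
    cubicPhase (y - 3 * τ * lam ^ 2) τ ω with hH
  have e : 𝓕⁻ (airySymbol lam τ) y = ∫ ξ, H (2 * Real.pi * ξ) := by
    rw [Real.fourierInv_eq']
    congr 1; ext ξ
    rw [hH]
    simp only [airySymbol, cubicPhase, smul_eq_mul]
    rw [mul_left_comm, ← Complex.exp_add]
    congr 2
    simp
    ring
  rw [e, Measure.integral_comp_mul_left, norm_smul, abs_of_pos (by positivity),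
    Real.norm_of_nonneg (by positivity)]
  have hb := norm_integral_gaussAmp_le (μ := 3 * τ * lam) (r := |lam| / √3) (by simp [hlam, hτ0])
    (by positivity) (y - 3 * τ * lam ^ 2) hδ hτ
  calc (2 * Real.pi)⁻¹ * ‖∫ ω, H ω‖ ≤ (2 * 3)⁻¹ * (72 / δ) := by
        gcongr
        exact Real.pi_gt_three.le
    _ = 12 / δ := by ring

theorem lintegral_airy_pow_eight_le {lam τ : ℝ} (hlam : lam ≠ 0) (hτ : τ ≠ 0) {w : ℝ → ℂ}
    (hwm : Measurable w) (hw : Integrable w) (hw2 : MemLp w 2) :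
    ∫⁻ x, ‖fourierMul (airySymbol lam τ) w x‖ₑ ^ 8 ≤
      ENNReal.ofReal (400 * 12 ^ 6 / τ ^ 2) * (∫⁻ y, ‖w y‖ₑ ^ (8 / 7 : ℝ)) ^ 7 := by
  set δ := |τ| ^ (1 / 3 : ℝ) with hδ
  have hδ0 : 0 < δ := Real.rpow_pos_of_pos (abs_pos.2 hτ) _
  have hδ3 : |τ| = δ ^ 3 := by
    rw [hδ, ← Real.rpow_natCast, ← Real.rpow_mul (abs_nonneg _)]; norm_num
  refine (lintegral_fourierMul_pow_eight_le (integrable_airySymbol hlam hτ)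
    (norm_airySymbol_le_one lam τ) (by positivity)
    (norm_fourierInv_airySymbol_le hlam hδ0 hδ3) hwm hw hw2).trans (le_of_eq ?_)
  congr 2
  rw [← sq_abs τ, hδ3]
  field_simp

end Airy

section Duhamel
open Set

/-- `v₁, v₂, v₃` are the spatial derivatives of `v`, `vt` is its time derivative, and `v` vanishes
for `|x| > R`. -/
structure SpatiallyCompact (v v₁ v₂ v₃ vt : ℝ × ℝ → ℝ) (R : ℝ) : Prop where
  cont : Continuous v
  cont₁ : Continuous v₁
  cont₂ : Continuous v₂
  cont₃ : Continuous v₃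
  contt : Continuous vt
  deriv₁ : ∀ x t, HasDerivAt (fun x => v (x, t)) (v₁ (x, t)) x
  deriv₂ : ∀ x t, HasDerivAt (fun x => v₁ (x, t)) (v₂ (x, t)) x
  deriv₃ : ∀ x t, HasDerivAt (fun x => v₂ (x, t)) (v₃ (x, t)) x
  derivt : ∀ x t, HasDerivAt (fun t => v (x, t)) (vt (x, t)) t
  supp : ∀ x t, R < |x| → v (x, t) = 0

theorem HasDerivAt.eq_zero_of_forall_lt_abs {f : ℝ → ℝ} {f' x R : ℝ} (hf : HasDerivAt f f' x)
    (h0 : ∀ y, R < |y| → f y = 0) (hx : R < |x|) : f' = 0 := by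
  refine hf.unique ((hasDerivAt_const x (0 : ℝ)).congr_of_eventuallyEq ?_)
  filter_upwards [(isOpen_lt continuous_const continuous_abs).mem_nhds hx] with y hy
  exact h0 y hy

namespace SpatiallyCompact

variable {v v₁ v₂ v₃ vt : ℝ × ℝ → ℝ} {R : ℝ}

theorem supp₁ (h : SpatiallyCompact v v₁ v₂ v₃ vt R) (x t : ℝ) (hx : R < |x|) :
    v₁ (x, t) = 0 :=
  (h.deriv₁ x t).eq_zero_of_forall_lt_abs (fun y => h.supp y t) hx

theorem supp₂ (h : SpatiallyCompact v v₁ v₂ v₃ vt R) (x t : ℝ) (hx : R < |x|) :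
    v₂ (x, t) = 0 :=
  (h.deriv₂ x t).eq_zero_of_forall_lt_abs (fun y => h.supp₁ y t) hx

theorem supp₃ (h : SpatiallyCompact v v₁ v₂ v₃ vt R) (x t : ℝ) (hx : R < |x|) :
    v₃ (x, t) = 0 :=
  (h.deriv₃ x t).eq_zero_of_forall_lt_abs (fun y => h.supp₂ y t) hx

theorem suppt (h : SpatiallyCompact v v₁ v₂ v₃ vt R) (x t : ℝ) (hx : R < |x|) :
    vt (x, t) = 0 := by
  refine (h.derivt x t).unique ?_
  simp only [h.supp x _ hx]
  exact hasDerivAt_const t 0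

end SpatiallyCompact

theorem integrable_of_forall_lt_abs {f : ℝ → ℂ} (hf : Continuous f) {R : ℝ}
    (hR : ∀ x, R < |x| → f x = 0) : Integrable f := by
  refine hf.integrable_of_hasCompactSupport (HasCompactSupport.intro (isCompact_Icc (a := -R)
    (b := R)) fun x hx => hR x ?_)
  by_contra! hle
  exact hx (abs_le.1 hle)

theorem integrable_prod_restrict_of_forall_lt_abs {f : ℝ × ℝ → ℂ} (hf : Continuous f) {R : ℝ}
    (hR : ∀ x t, R < |x| → f (x, t) = 0) (a b : ℝ) :
    Integrable f (volume.prod (volume.restrict (Icc a b))) := by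
  have h1 : IntegrableOn f (univ ×ˢ Icc a b) := by
    refine ((hf.continuousOn.integrableOn_compact
      (isCompact_Icc.prod isCompact_Icc : IsCompact (Icc (-R) R ×ˢ Icc a b)))
      ).of_forall_sdiff_eq_zero (MeasurableSet.univ.prod measurableSet_Icc) fun p hp => ?_
    refine hR p.1 p.2 ?_
    by_contra! hle
    exact hp.2 ⟨abs_le.1 hle, hp.1.2⟩
  rwa [IntegrableOn, Measure.volume_eq_prod, ← Measure.prod_restrict, Measure.restrict_univ] at h1

theorem integral_exp_mul_deriv {f f' : ℝ → ℝ} (hf : Continuous f) (hf' : Continuous f')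
    (hd : ∀ x, HasDerivAt f (f' x) x) {R : ℝ} (h0 : ∀ x, R < |x| → f x = 0) (z : ℂ) :
    ∫ x : ℝ, Complex.exp (-(z * x)) * (f' x : ℂ) =
      z * ∫ x : ℝ, Complex.exp (-(z * x)) * (f x : ℂ) := by
  have h0' : ∀ x, R < |x| → f' x = 0 := fun x hx => (hd x).eq_zero_of_forall_lt_abs h0 hx
  have he : ∀ x : ℝ, HasDerivAt (fun x : ℝ => Complex.exp (-(z * x)))
      (-(z * Complex.exp (-(z * x)))) x := by
    intro x
    have h1 : HasDerivAt (fun x : ℝ => -(z * x)) (-(z * 1)) x :=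
      ((hasDerivAt_id x).ofReal_comp.const_mul z).neg
    convert h1.cexp using 1; ring
  rw [integral_mul_deriv_eq_deriv_mul_of_integrable (fun x _ => he x)
    (fun x _ => (hd x).ofReal_comp), ← integral_const_mul, ← integral_neg]
  · congr 1; ext x; ring
  · exact integrable_of_forall_lt_abs (R := R) (by fun_prop) fun x hx => by simp [h0' x hx]
  · exact integrable_of_forall_lt_abs (R := R) (by fun_prop) fun x hx => by simp [h0 x hx]
  · exact integrable_of_forall_lt_abs (R := R) (by fun_prop) fun x hx => by simp [h0 x hx]

theorem SpatiallyCompact.duhamel {v v₁ v₂ v₃ vt : ℝ × ℝ → ℝ} {R : ℝ}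
    (h : SpatiallyCompact v v₁ v₂ v₃ vt R) (z : ℂ) {a b : ℝ} (hab : a ≤ b) :
    Complex.exp (z ^ 3 * b) * (∫ x : ℝ, Complex.exp (-(z * x)) * (v (x, b) : ℂ)) -
      Complex.exp (z ^ 3 * a) * (∫ x : ℝ, Complex.exp (-(z * x)) * (v (x, a) : ℂ)) =
    ∫ s in a..b, Complex.exp (z ^ 3 * s) *
      ∫ x : ℝ, Complex.exp (-(z * x)) * ((vt (x, s) + v₃ (x, s) : ℝ) : ℂ) := by
  have hc := h.cont
  have hc₁ := h.cont₁
  have hc₂ := h.cont₂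
  have hc₃ := h.cont₃
  have hct := h.contt
  have hslice : ∀ {w : ℝ × ℝ → ℝ} (s : ℝ), Continuous w → (∀ x t, R < |x| → w (x, t) = 0) →
      Integrable fun x : ℝ => Complex.exp (-(z * x)) * (w (x, s) : ℂ) := by
    intro w s hw h0
    exact integrable_of_forall_lt_abs (R := R) (by fun_prop) fun x hx => by simp [h0 x s hx]
  set G : ℝ × ℝ → ℂ := fun p => Complex.exp (-(z * p.1)) * (Complex.exp (z ^ 3 * p.2) *
    (vt p + z ^ 3 * v p)) with hG
  have hGc : Continuous G := by fun_prop
  have hibp : ∀ s : ℝ, Complex.exp (z ^ 3 * s) *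
      (∫ x : ℝ, Complex.exp (-(z * x)) * ((vt (x, s) + v₃ (x, s) : ℝ) : ℂ)) = ∫ x, G (x, s) := by
    intro s
    have e3 : ∫ x : ℝ, Complex.exp (-(z * x)) * (v₃ (x, s) : ℂ) =
        z ^ 3 * ∫ x : ℝ, Complex.exp (-(z * x)) * (v (x, s) : ℂ) := by
      rw [integral_exp_mul_deriv (by fun_prop) (by fun_prop) (fun x => h.deriv₃ x s)
          (fun x => h.supp₂ x s),
        integral_exp_mul_deriv (by fun_prop) (by fun_prop) (fun x => h.deriv₂ x s)
          (fun x => h.supp₁ x s),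
        integral_exp_mul_deriv (by fun_prop) (by fun_prop) (fun x => h.deriv₁ x s)
          (fun x => h.supp x s)]
      ring
    simp_rw [Complex.ofReal_add, mul_add]
    rw [integral_add (hslice s hct h.suppt) (hslice s hc₃ h.supp₃), e3, ← integral_const_mul,
      ← integral_add (hslice s hct h.suppt) ((hslice s hc h.supp).const_mul _),
      ← integral_const_mul]
    congr 1; ext x
    simp only [hG]; ring
  simp_rw [hibp]
  rw [intervalIntegral_integral_swap (f := fun s x => G (x, s))]
  · have hftc : ∀ x : ℝ, ∫ s in a..b, G (x, s) =
        Complex.exp (z ^ 3 * b) * (Complex.exp (-(z * x)) * (v (x, b) : ℂ)) -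
          Complex.exp (z ^ 3 * a) * (Complex.exp (-(z * x)) * (v (x, a) : ℂ)) := by
      intro x
      rw [intervalIntegral.integral_eq_sub_of_hasDerivAt (f := fun s : ℝ =>
        Complex.exp (z ^ 3 * s) * (Complex.exp (-(z * x)) * (v (x, s) : ℂ)))]
      · intro s _
        have h1 : HasDerivAt (fun s : ℝ => z ^ 3 * s) (z ^ 3 * 1) s :=
          (hasDerivAt_id s).ofReal_comp.const_mul _
        refine (h1.cexp.fun_mul
          ((h.derivt x s).ofReal_comp.const_mul (Complex.exp (-(z * x))))).congr_deriv ?_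
        simp only [hG]; ring
      · exact (by fun_prop : Continuous fun s => G (x, s)).intervalIntegrable _ _
    rw [integral_congr_ae (Filter.Eventually.of_forall hftc),
      integral_sub ((hslice b hc h.supp).const_mul _) ((hslice a hc h.supp).const_mul _),
      integral_const_mul, integral_const_mul]
  · rw [uIoc_of_le hab]
    refine Integrable.mono_measure (integrable_prod_restrict_of_forall_lt_abs (R := R) hGc
      (fun x t hx => ?_) a b).swap (Measure.prod_mono
      (Measure.restrict_mono Ioc_subset_Icc_self le_rfl) le_rfl)
    simp [hG, h.supp x t hx, h.suppt x t hx]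

end Duhamel

section Representation
open Set FourierTransform

/-- The slice `x ↦ e ^ (lam * x) * w (x, t)`. -/
noncomputable def expWeight (lam : ℝ) (w : ℝ × ℝ → ℝ) (t : ℝ) : ℝ → ℂ :=
  fun x => ((Real.exp (lam * x) * w (x, t) : ℝ) : ℂ)

theorem continuous_expWeight (lam : ℝ) {w : ℝ × ℝ → ℝ} (hw : Continuous w) (t : ℝ) :
    Continuous (expWeight lam w t) := by
  unfold expWeight; fun_prop

theorem expWeight_eq_zero (lam : ℝ) {w : ℝ × ℝ → ℝ} {R : ℝ}
    (h0 : ∀ x t, R < |x| → w (x, t) = 0) (t x : ℝ) (hx : R < |x|) : expWeight lam w t x = 0 := by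
  simp [expWeight, h0 x t hx]

theorem fourier_expWeight (lam : ℝ) (w : ℝ × ℝ → ℝ) (t ξ : ℝ) :
    𝓕 (expWeight lam w t) ξ =
      ∫ x : ℝ, Complex.exp (-(airyExponent lam ξ * x)) * (w (x, t) : ℂ) := by
  rw [Real.fourier_real_eq_integral_exp_smul]
  congr 1; ext x
  rw [expWeight, smul_eq_mul, Complex.ofReal_mul (Real.exp (lam * x)),
    Complex.ofReal_exp, ← mul_assoc,
    ← Complex.exp_add]
  congr 2
  simp [airyExponent]
  ring

theorem ae_airyExponent_pow_three_re_ne_zero {lam : ℝ} (hlam : lam ≠ 0) :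
    ∀ᵐ ξ : ℝ, (airyExponent lam ξ ^ 3).re ≠ 0 := by
  refine (((Set.finite_singleton (-(|lam| / √3 / (2 * Real.pi)))).insert
    (|lam| / √3 / (2 * Real.pi))).countable.ae_notMem volume).mono fun ξ hξ h => hξ ?_
  rw [airyExponent_pow_three_re] at h
  have h1 := (mul_eq_zero.1 h).resolve_left hlam
  have h3 : (|lam| / √3) ^ 2 = lam ^ 2 / 3 := by
    rw [div_pow, Real.sq_sqrt (by norm_num), sq_abs]
  have h2 : (2 * Real.pi * ξ) ^ 2 = (|lam| / √3) ^ 2 := by rw [h3]; linarith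
  have hpi : (2 * Real.pi : ℝ) ≠ 0 := by positivity
  rw [mem_insert_iff, mem_singleton_iff, ← neg_div]
  exact (sq_eq_sq_iff_eq_or_eq_neg.1 h2).imp (fun h => eq_div_of_mul_eq hpi (by rw [mul_comm, h]))
    fun h => eq_div_of_mul_eq hpi (by rw [mul_comm, h])

noncomputable def timeSign (t s : ℝ) : ℂ := if s < t then 1 else -1

theorem norm_timeSign (t s : ℝ) : ‖timeSign t s‖ = 1 := by
  unfold timeSign; split_ifs <;> simp

theorem measurable_timeSign (t : ℝ) : Measurable (timeSign t) :=
  Measurable.ite measurableSet_Iio measurable_const measurable_const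

theorem measurable_fourier_expWeight (lam : ℝ) {w : ℝ × ℝ → ℝ} (hw : Continuous w) :
    Measurable fun p : ℝ × ℝ => 𝓕 (expWeight lam w p.2) p.1 := by
  simp_rw [fourier_expWeight]
  have h : Continuous fun q : (ℝ × ℝ) × ℝ =>
      Complex.exp (-(airyExponent lam q.1.1 * q.2)) * (w (q.2, q.1.2) : ℂ) := by
    unfold airyExponent; fun_prop
  exact h.stronglyMeasurable.integral_prod_right'.measurable

theorem norm_fourier_expWeight_le (lam : ℝ) {w : ℝ × ℝ → ℝ} (hw : Continuous w) {R : ℝ}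
    (h0 : ∀ x t, R < |x| → w (x, t) = 0) :
    ∃ C : ℝ, 0 ≤ C ∧ ∀ t ∈ Icc (0 : ℝ) 1, ∀ ξ, ‖𝓕 (expWeight lam w t) ξ‖ ≤ C := by
  have hc : Continuous fun p : ℝ × ℝ => Real.exp (lam * p.1) * w p := by fun_prop
  obtain ⟨C, hC⟩ := (isCompact_Icc.prod isCompact_Icc :
    IsCompact (Icc (-R) R ×ˢ Icc (0 : ℝ) 1)).exists_bound_of_continuousOn hc.continuousOn
  refine ⟨|C| * (volume (Icc (-R) R)).toReal, by positivity, fun t ht ξ => ?_⟩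
  refine (norm_fourier_le _ _).trans ?_
  have hle : ∀ x, ‖expWeight lam w t x‖ ≤ (Icc (-R) R).indicator (fun _ => |C|) x := by
    intro x
    by_cases hx : x ∈ Icc (-R) R
    · rw [indicator_of_mem hx, expWeight, Complex.norm_real]
      exact (hC (x, t) ⟨hx, ht⟩).trans (le_abs_self C)
    · rw [indicator_of_notMem hx, expWeight_eq_zero lam h0 t x, norm_zero]
      by_contra! hle
      exact hx (abs_le.1 hle)
  refine (integral_mono_of_nonneg (Filter.Eventually.of_forall fun x => norm_nonneg _)
    ((integrable_indicator_iff measurableSet_Icc).2 (integrableOn_const (by simp)))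
    (Filter.Eventually.of_forall hle)).trans (le_of_eq ?_)
  rw [integral_indicator measurableSet_Icc, setIntegral_const, smul_eq_mul, mul_comm]
  rfl

theorem integrableOn_abs_sub_rpow {t : ℝ} (ht : t ∈ Icc (0 : ℝ) 1) :
    IntegrableOn (fun s => |t - s| ^ (-(1 / 2) : ℝ)) (Icc 0 1) := by
  have h1 : IntervalIntegrable (fun s : ℝ => |s| ^ (-(1 / 2) : ℝ)) volume 0 1 := by
    refine (intervalIntegral.intervalIntegrable_rpow' (r := -(1 / 2)) (by norm_num)).congr ?_
    intro s hs
    rw [uIoc_of_le zero_le_one] at hs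
    simp only [abs_of_pos hs.1]
  have h2 : IntervalIntegrable (fun s : ℝ => |s| ^ (-(1 / 2) : ℝ)) volume (-1) 1 := by
    refine IntervalIntegrable.trans (b := 0) ?_ h1
    have := (IntervalIntegrable.iff_comp_neg (f := fun s : ℝ => |s| ^ (-(1 / 2) : ℝ))).1 h1
    simpa using this.symm
  have h3 := (h2.comp_sub_left t).symm
  rw [intervalIntegrable_iff_integrableOn_Icc_of_le (by linarith)] at h3
  exact h3.mono_set (Icc_subset_Icc (by linarith [ht.2]) (by linarith [ht.1]))

theorem integrable_gaussian_abs_sub {t b : ℝ} (ht : t ∈ Icc (0 : ℝ) 1) (hb : 0 < b) :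
    Integrable (fun p : ℝ × ℝ => Real.exp (-(b * |t - p.2|) * p.1 ^ 2))
      (volume.prod (volume.restrict (Icc (0 : ℝ) 1))) := by
  have hne : ∀ᵐ s : ℝ ∂(volume.restrict (Icc (0 : ℝ) 1)), s ≠ t :=
    ae_restrict_of_ae (by simp [ae_iff])
  rw [integrable_prod_iff' (by fun_prop)]
  refine ⟨hne.mono fun s hs => ?_, ?_⟩
  · exact integrable_exp_neg_mul_sq (mul_pos hb (abs_pos.2 (sub_ne_zero.2 hs.symm)))
  · refine ((integrableOn_abs_sub_rpow ht).const_mul √(Real.pi / b)).congr (hne.mono fun s hs => ?_)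
    have hp : 0 < |t - s| := abs_pos.2 (sub_ne_zero.2 hs.symm)
    simp only [Real.norm_eq_abs, Real.abs_exp]
    rw [integral_gaussian, Real.sqrt_eq_rpow, Real.sqrt_eq_rpow, div_mul_eq_div_div,
      Real.div_rpow (by positivity) hp.le, Real.rpow_neg hp.le]
    rfl

theorem integrable_airySymbol_mul_fourier {lam : ℝ} (hlam : lam ≠ 0) {w : ℝ × ℝ → ℝ}
    (hw : Continuous w) {R : ℝ} (h0 : ∀ x t, R < |x| → w (x, t) = 0) {t : ℝ}
    (ht : t ∈ Icc (0 : ℝ) 1) :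
    Integrable (fun p : ℝ × ℝ => airySymbol lam (t - p.2) p.1 * 𝓕 (expWeight lam w p.2) p.1)
      (volume.prod (volume.restrict (Icc (0 : ℝ) 1))) := by
  obtain ⟨C, hC0, hC⟩ := norm_fourier_expWeight_le lam hw h0
  have hmeas : Measurable fun p : ℝ × ℝ =>
      airySymbol lam (t - p.2) p.1 * 𝓕 (expWeight lam w p.2) p.1 :=
    ((measurable_airySymbol lam).comp
      (by fun_prop : Measurable fun p : ℝ × ℝ => (t - p.2, p.1))).mul
      (measurable_fourier_expWeight lam hw)
  refine ((integrable_gaussian_abs_sub ht (b := 3 * |lam| * (2 * Real.pi) ^ 2)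
    (by positivity)).const_mul (Real.exp (3 * |lam| * (|lam| / √3) ^ 2) * C)).mono'
    hmeas.aestronglyMeasurable ?_
  have hae : ∀ᵐ p : ℝ × ℝ ∂(volume.prod (volume.restrict (Icc (0 : ℝ) 1))),
      p.2 ∈ Icc (0 : ℝ) 1 :=
    Measure.quasiMeasurePreserving_snd.ae (ae_restrict_mem measurableSet_Icc)
  filter_upwards [hae] with p hp
  rw [norm_mul, norm_airySymbol]
  have hμ : |3 * (t - p.2) * lam| = 3 * |lam| * |t - p.2| := by
    rw [abs_mul, abs_mul, abs_of_pos (by norm_num : (0 : ℝ) < 3)]; ring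
  have h1 : |t - p.2| ≤ 1 := abs_le.2 ⟨by linarith [ht.1, hp.2], by linarith [ht.2, hp.1]⟩
  calc _ ≤ (Real.exp (|3 * (t - p.2) * lam| * (|lam| / √3) ^ 2) *
        Real.exp (-|3 * (t - p.2) * lam| * (2 * Real.pi * p.1) ^ 2)) * C :=
        mul_le_mul (gaussAmp_le_exp _ _ _) (hC _ hp _) (norm_nonneg _) (by positivity)
    _ ≤ (Real.exp (3 * |lam| * (|lam| / √3) ^ 2) *
        Real.exp (-|3 * (t - p.2) * lam| * (2 * Real.pi * p.1) ^ 2)) * C := by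
        gcongr
        rw [hμ]
        exact mul_le_of_le_one_right (by positivity) h1
    _ = _ := by rw [hμ]; ring_nf

theorem SpatiallyCompact.fourier_eq {v v₁ v₂ v₃ vt : ℝ × ℝ → ℝ} {R : ℝ}
    (h : SpatiallyCompact v v₁ v₂ v₃ vt R) (hv0 : ∀ x, v (x, 0) = 0) (hv1 : ∀ x, v (x, 1) = 0)
    (lam : ℝ) {t ξ : ℝ} (ht : t ∈ Icc (0 : ℝ) 1) (hξ : (airyExponent lam ξ ^ 3).re ≠ 0) :
    𝓕 (expWeight lam v t) ξ = ∫ s in Icc (0 : ℝ) 1,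
      timeSign t s * (airySymbol lam (t - s) ξ * 𝓕 (expWeight lam (fun p => vt p + v₃ p) s) ξ) := by
  set ζ := airyExponent lam ξ with hζ
  set K : ℝ → ℂ := fun s => 𝓕 (expWeight lam (fun p => vt p + v₃ p) s) ξ with hK
  have hexp : ∀ s : ℝ, Complex.exp (-(((t - s : ℝ) : ℂ) * ζ ^ 3)) =
      Complex.exp (-(ζ ^ 3 * t)) * Complex.exp (ζ ^ 3 * s) := by
    intro s
    rw [← Complex.exp_add]; congr 1; push_cast; ring
  have hcancel : ∀ z : ℂ, Complex.exp (-(ζ ^ 3 * t)) * (Complex.exp (ζ ^ 3 * t) * z) = z := by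
    intro z
    rw [← mul_assoc, ← Complex.exp_add]; simp
  have hduh : ∀ {a b : ℝ}, a ≤ b → Complex.exp (ζ ^ 3 * b) * 𝓕 (expWeight lam v b) ξ -
      Complex.exp (ζ ^ 3 * a) * 𝓕 (expWeight lam v a) ξ =
      ∫ s in a..b, Complex.exp (ζ ^ 3 * s) * K s := by
    intro a b hab
    simp only [hK, fourier_expWeight]
    exact h.duhamel ζ hab
  have hz0 : 𝓕 (expWeight lam v 0) ξ = 0 := by simp [fourier_expWeight, hv0]
  have hz1 : 𝓕 (expWeight lam v 1) ξ = 0 := by simp [fourier_expWeight, hv1]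
  rcases hξ.lt_or_gt with ha | ha
  · have hpoint : ∀ s, timeSign t s * (airySymbol lam (t - s) ξ * K s) =
        (Ioi t).indicator (fun s => -Complex.exp (-(ζ ^ 3 * t)) *
          (Complex.exp (ζ ^ 3 * s) * K s)) s := by
      intro s
      rw [airySymbol_eq]
      by_cases hs : t < s
      · rw [indicator_of_mem (show s ∈ Ioi t from hs), timeSign, if_neg hs.not_gt,
          if_pos (mul_pos_of_neg_of_neg (by linarith) ha), hexp]
        ring
      · rw [indicator_of_notMem (show s ∉ Ioi t from hs), if_neg]
        · simp
        · exact not_lt.2 (mul_nonpos_of_nonneg_of_nonpos (by linarith) ha.le)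
    have hset : Ioi t ∩ Icc 0 1 = Ioc t 1 := by
      ext s; simp only [mem_inter_iff, mem_Ioi, mem_Icc, mem_Ioc]
      exact ⟨fun hh => ⟨hh.1, hh.2.2⟩, fun hh => ⟨hh.1, ht.1.trans hh.1.le, hh.2⟩⟩
    rw [integral_congr_ae (Filter.Eventually.of_forall hpoint)]
    rw [setIntegral_indicator measurableSet_Ioi, inter_comm, hset, integral_const_mul,
      ← intervalIntegral.integral_of_le ht.2, ← hduh ht.2, hz1, mul_zero, zero_sub, neg_mul_neg,
      hcancel]
  · have hpoint : ∀ s, timeSign t s * (airySymbol lam (t - s) ξ * K s) =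
        (Iio t).indicator (fun s => Complex.exp (-(ζ ^ 3 * t)) *
          (Complex.exp (ζ ^ 3 * s) * K s)) s := by
      intro s
      rw [airySymbol_eq]
      by_cases hs : s < t
      · rw [indicator_of_mem (show s ∈ Iio t from hs), timeSign, if_pos hs,
          if_pos (mul_pos (by linarith) ha), hexp]
        ring
      · rw [indicator_of_notMem (show s ∉ Iio t from hs), if_neg]
        · simp
        · exact not_lt.2 (mul_nonpos_of_nonpos_of_nonneg (by linarith) ha.le)
    have hset : Iio t ∩ Icc 0 1 = Ico 0 t := by
      ext s; simp only [mem_inter_iff, mem_Iio, mem_Icc, mem_Ico]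
      exact ⟨fun hh => ⟨hh.2.1, hh.1⟩, fun hh => ⟨hh.2, hh.1, hh.2.le.trans ht.2⟩⟩
    rw [integral_congr_ae (Filter.Eventually.of_forall hpoint)]
    rw [setIntegral_indicator measurableSet_Iio, inter_comm, hset, integral_const_mul,
      integral_Ico_eq_integral_Ioc, ← intervalIntegral.integral_of_le ht.1, ← hduh ht.1, hz0,
      mul_zero, sub_zero, hcancel]

theorem SpatiallyCompact.enorm_expWeight_le {v v₁ v₂ v₃ vt : ℝ × ℝ → ℝ} {R : ℝ}
    (h : SpatiallyCompact v v₁ v₂ v₃ vt R) (hv0 : ∀ x, v (x, 0) = 0) (hv1 : ∀ x, v (x, 1) = 0)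
    {lam : ℝ} (hlam : lam ≠ 0) {t : ℝ} (ht : t ∈ Icc (0 : ℝ) 1) (x : ℝ) :
    ‖expWeight lam v t x‖ₑ ≤ ∫⁻ s in Icc (0 : ℝ) 1,
      ‖fourierMul (airySymbol lam (t - s)) (expWeight lam (fun p => vt p + v₃ p) s) x‖ₑ := by
  set w : ℝ × ℝ → ℝ := fun p => vt p + v₃ p with hw
  have hwc : Continuous w := h.contt.add h.cont₃
  have hw0 : ∀ x t, R < |x| → w (x, t) = 0 := fun x t hx => by
    simp [hw, h.suppt x t hx, h.supp₃ x t hx]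
  have hK := integrable_airySymbol_mul_fourier hlam hwc hw0 ht
  have hK' : Integrable (fun p : ℝ × ℝ => timeSign t p.2 *
      (airySymbol lam (t - p.2) p.1 * 𝓕 (expWeight lam w p.2) p.1))
      (volume.prod (volume.restrict (Icc (0 : ℝ) 1))) :=
    hK.bdd_mul (c := 1) ((measurable_timeSign t).comp measurable_snd).aestronglyMeasurable
      (Filter.Eventually.of_forall fun p => (norm_timeSign t p.2).le)
  have hae : 𝓕 (expWeight lam v t) =ᵐ[volume] fun ξ => ∫ s in Icc (0 : ℝ) 1,
      timeSign t s * (airySymbol lam (t - s) ξ * 𝓕 (expWeight lam w s) ξ) :=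
    (ae_airyExponent_pow_three_re_ne_zero hlam).mono fun ξ hξ => h.fourier_eq hv0 hv1 lam ht hξ
  have hvc := continuous_expWeight lam h.cont t
  have hvi := integrable_of_forall_lt_abs hvc (expWeight_eq_zero lam h.supp t)
  have hinv := hvc.fourierInv_fourier_eq hvi (hK'.integral_prod_left.congr hae.symm)
  have hrep : expWeight lam v t x = ∫ s in Icc (0 : ℝ) 1,
      timeSign t s * fourierMul (airySymbol lam (t - s)) (expWeight lam w s) x := by
    rw [← congrFun hinv x, Real.fourierInv_congr_ae hae]
    simp_rw [fourierMul, Real.fourierInv_eq, Circle.smul_def, smul_eq_mul]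
    simp_rw [← integral_const_mul]
    rw [integral_integral_swap]
    · congr 1; ext s; congr 1; ext ξ; ring
    · refine hK'.bdd_mul (c := 1)
        (f := fun p : ℝ × ℝ => ((Real.fourierChar (inner ℝ p.1 x) : Circle) : ℂ))
        ?_ ?_
      · exact (by fun_prop : Continuous _).aestronglyMeasurable
      · exact Filter.Eventually.of_forall fun p => (Circle.norm_coe _).le
  rw [hrep]
  refine (enorm_integral_le_lintegral_enorm _).trans (lintegral_mono fun s => ?_)
  rw [enorm_mul, ← ofReal_norm (timeSign t s), norm_timeSign]
  simp

theorem measurable_fourierInv_prod {α : Type*} [MeasurableSpace α] {F : α × ℝ → ℂ}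
    (hF : Measurable F) :
    Measurable fun p : ℝ × α => 𝓕⁻ (fun ξ => F (p.2, ξ)) p.1 := by
  simp_rw [Real.fourierInv_eq']
  have h0 : Measurable fun q : (ℝ × α) × ℝ =>
      Complex.exp (((2 * Real.pi * inner ℝ q.2 q.1.1 : ℝ) : ℂ) * Complex.I) := by
    have : Continuous fun r : ℝ × ℝ =>
      Complex.exp (((2 * Real.pi * inner ℝ r.2 r.1 : ℝ) : ℂ) * Complex.I) := by fun_prop
    exact this.measurable.comp (by fun_prop : Measurable fun q : (ℝ × α) × ℝ => (q.1.1, q.2))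
  have h1 : Measurable fun q : (ℝ × α) × ℝ => F (q.1.2, q.2) := hF.comp (by fun_prop)
  exact (h0.smul h1).stronglyMeasurable.integral_prod_right'.measurable

theorem measurable_fourierMul_airySymbol (lam t : ℝ) {w : ℝ × ℝ → ℝ} (hw : Continuous w) :
    Measurable fun p : ℝ × ℝ =>
      fourierMul (airySymbol lam (t - p.2)) (expWeight lam w p.2) p.1 := by
  have h1 : Measurable fun q : ℝ × ℝ => airySymbol lam (t - q.1) q.2 := by
    have h3 : Measurable fun q : ℝ × ℝ => (t - q.1, q.2) :=
      (measurable_const.sub measurable_fst).prodMk measurable_snd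
    have h4 := (measurable_airySymbol lam).comp h3
    simpa only [Function.comp_def] using h4
  have h2 : Measurable fun q : ℝ × ℝ => 𝓕 (expWeight lam w q.1) q.2 := by
    have h4 := (measurable_fourier_expWeight lam hw).comp measurable_swap
    simpa only [Function.comp_def, Prod.fst_swap, Prod.snd_swap] using h4
  have h5 := measurable_fourierInv_prod (F := fun q : ℝ × ℝ =>
    airySymbol lam (t - q.1) q.2 * 𝓕 (expWeight lam w q.1) q.2) (h1.mul h2)
  simpa only [fourierMul] using h5

end Representation

section MixedNorm
open Set FourierTransform
open scoped ENNReal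

theorem lintegral_pow_eight_rpow_le {X S : Type*} [MeasurableSpace X] [MeasurableSpace S]
    {μ : Measure X} [SFinite μ] {ν : Measure S} [SFinite ν] {U : X → ℝ≥0∞} (hU : Measurable U)
    {W : X × S → ℝ≥0∞} (hW : Measurable W) (hUW : ∀ x, U x ≤ ∫⁻ s, W (x, s) ∂ν)
    (hfin : ∫⁻ x, U x ^ 8 ∂μ ≠ ∞) :
    (∫⁻ x, U x ^ 8 ∂μ) ^ (1 / 8 : ℝ) ≤ ∫⁻ s, (∫⁻ x, W (x, s) ^ 8 ∂μ) ^ (1 / 8 : ℝ) ∂ν := by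
  set A := ∫⁻ x, U x ^ 8 ∂μ with hA
  rcases eq_or_ne A 0 with hA0 | hA0
  · rw [hA0, ENNReal.zero_rpow_of_pos (by norm_num)]
    exact zero_le
  have hq : (8 : ℝ).HolderConjugate (8 / 7) :=
    (Real.holderConjugate_iff (p := 8) (q := 8 / 7)).2 ⟨by norm_num, by norm_num⟩
  have hslice : ∀ s, ∫⁻ x, U x ^ 7 * W (x, s) ∂μ ≤
      A ^ (7 / 8 : ℝ) * (∫⁻ x, W (x, s) ^ 8 ∂μ) ^ (1 / 8 : ℝ) := by
    intro s
    have hWs : Measurable fun x => W (x, s) := hW.comp measurable_prodMk_right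
    have h := ENNReal.lintegral_mul_le_Lp_mul_Lq μ hq hWs.aemeasurable (hU.pow_const 7).aemeasurable
    have e1 : ∀ x, (U x ^ 7) ^ (8 / 7 : ℝ) = U x ^ 8 := by
      intro x
      rw [← ENNReal.rpow_natCast, ← ENNReal.rpow_mul, ← ENNReal.rpow_natCast]
      norm_num
    have e2 : ∀ x, W (x, s) ^ (8 : ℝ) = W (x, s) ^ 8 := fun x => by
      rw [← ENNReal.rpow_natCast]; norm_num
    simp only [Pi.mul_apply, e1, e2] at h
    rw [mul_comm]
    convert h using 2
    · exact funext fun x => mul_comm _ _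
    · norm_num [hA]
  have hmain : A ≤ A ^ (7 / 8 : ℝ) * ∫⁻ s, (∫⁻ x, W (x, s) ^ 8 ∂μ) ^ (1 / 8 : ℝ) ∂ν := by
    calc A ≤ ∫⁻ x, U x ^ 7 * ∫⁻ s, W (x, s) ∂ν ∂μ := by
          refine lintegral_mono fun x => ?_
          rw [pow_succ]
          exact mul_le_mul_right (hUW x) _
      _ = ∫⁻ x, ∫⁻ s, U x ^ 7 * W (x, s) ∂ν ∂μ := by
          refine lintegral_congr fun x => ?_
          exact (lintegral_const_mul _ (hW.comp measurable_prodMk_left)).symm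
      _ = ∫⁻ s, ∫⁻ x, U x ^ 7 * W (x, s) ∂μ ∂ν :=
          lintegral_lintegral_swap (((hU.pow_const 7).comp measurable_fst).mul hW).aemeasurable
      _ ≤ ∫⁻ s, A ^ (7 / 8 : ℝ) * (∫⁻ x, W (x, s) ^ 8 ∂μ) ^ (1 / 8 : ℝ) ∂ν :=
          lintegral_mono hslice
      _ = _ := lintegral_const_mul _
          ((hW.pow_const 8).lintegral_prod_left'.pow_const _)
  have hsplit : A ^ (7 / 8 : ℝ) * A ^ (1 / 8 : ℝ) = A := by
    rw [← ENNReal.rpow_add _ _ hA0 hfin]; norm_num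
  have h0 : A ^ (7 / 8 : ℝ) ≠ 0 := by
    simp [ENNReal.rpow_eq_zero_iff, hA0, hfin]
  have h1 : A ^ (7 / 8 : ℝ) ≠ ∞ := ENNReal.rpow_ne_top_of_nonneg (by norm_num) hfin
  refine (ENNReal.mul_le_mul_iff_right h0 h1).1 ?_
  rwa [hsplit]

theorem lintegral_pow_eight_le_of_le_lintegral_rieszKernel {f N : ℝ → ℝ≥0∞} (hf : Measurable f)
    (hf' : ∀ t, f t ≠ ∞) (hN : Measurable N) (hN' : ∀ s, N s ≠ ∞) (hNi : ∫⁻ s, N s ≠ ∞)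
    (hfN : ∀ t, f t ≤ ∫⁻ s, rieszKernel (t - s) * N s ^ (7 / 8 : ℝ)) :
    ∫⁻ t, f t ^ 8 ≤ ENNReal.ofReal (2 * 10 ^ 8) * (∫⁻ s, N s) ^ 7 := by
  rcases eq_or_ne (∫⁻ s, N s) 0 with h0 | h0
  · have hN0 : N =ᵐ[volume] 0 := (lintegral_eq_zero_iff hN).1 h0
    have hf0 : ∀ t, f t = 0 := fun t => by
      refine le_antisymm ((hfN t).trans (le_of_eq ?_)) zero_le
      rw [lintegral_congr_ae (g := fun _ => 0) (hN0.mono fun s hs => ?_), lintegral_zero]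
      simp only [hs, Pi.zero_apply]
      rw [ENNReal.zero_rpow_of_pos (by norm_num), mul_zero]
    simp [hf0]
  set v : ℝ → ℝ := fun s => (N s ^ (1 / 8 : ℝ)).toReal with hv
  have hvof : ∀ s, ENNReal.ofReal (v s) = N s ^ (1 / 8 : ℝ) := fun s =>
    ENNReal.ofReal_toReal (ENNReal.rpow_ne_top_of_nonneg (by norm_num) (hN' s))
  have hv0 : ∀ s, 0 ≤ v s := fun s => ENNReal.toReal_nonneg
  have hv7 : ∀ s, ENNReal.ofReal (v s ^ 7) = N s ^ (7 / 8 : ℝ) := fun s => by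
    rw [ENNReal.ofReal_pow (hv0 s), hvof, ← ENNReal.rpow_natCast, ← ENNReal.rpow_mul]; norm_num
  have hv8 : ∀ s, ENNReal.ofReal (v s ^ 8) = N s := fun s => by
    rw [ENNReal.ofReal_pow (hv0 s), hvof, ← ENNReal.rpow_natCast, ← ENNReal.rpow_mul]; norm_num
  set m : ℝ := ((∫⁻ s, N s) ^ (1 / 8 : ℝ)).toReal with hm
  have hmof : ENNReal.ofReal m = (∫⁻ s, N s) ^ (1 / 8 : ℝ) :=
    ENNReal.ofReal_toReal (ENNReal.rpow_ne_top_of_nonneg (by norm_num) hNi)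
  have hm0 : 0 < m := ENNReal.toReal_pos (by simp [ENNReal.rpow_eq_zero_iff, h0])
    (ENNReal.rpow_ne_top_of_nonneg (by norm_num) hNi)
  have h := lintegral_pow_eight_le_of_le_rieszKernel (f := fun t => (f t).toReal) (v := v) (m := m)
    hf.ennreal_toReal (fun t => ENNReal.toReal_nonneg) (hN.pow_const _).ennreal_toReal hv0 hm0
    (by
      simp only [hv8]
      rw [ENNReal.ofReal_pow hm0.le, hmof, ← ENNReal.rpow_natCast, ← ENNReal.rpow_mul]; norm_num)
    (fun t => by
      simp only [hv7, ENNReal.ofReal_toReal (hf' t)]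
      exact hfN t)
  simp only [ENNReal.ofReal_toReal (hf' _)] at h
  refine h.trans (le_of_eq ?_)
  rw [ENNReal.ofReal_mul (by norm_num), ENNReal.ofReal_pow hm0.le, hmof, ← ENNReal.rpow_natCast,
    ← ENNReal.rpow_mul, ← ENNReal.rpow_natCast (∫⁻ s, N s)]
  norm_num

theorem memLp_two_of_forall_lt_abs {f : ℝ → ℂ} (hf : Continuous f) {R : ℝ}
    (hR : ∀ x, R < |x| → f x = 0) : MemLp f 2 := by
  refine hf.memLp_of_hasCompactSupport (HasCompactSupport.intro (isCompact_Icc (a := -R)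
    (b := R)) fun x hx => hR x ?_)
  by_contra! hle
  exact hx (abs_le.1 hle)

theorem exists_lintegral_expWeight_rpow_le (lam : ℝ) {w : ℝ × ℝ → ℝ} (hw : Continuous w) {R : ℝ}
    (h0 : ∀ x t, R < |x| → w (x, t) = 0) {r : ℝ} (hr : 0 < r) :
    ∃ B : ℝ≥0∞, B ≠ ∞ ∧ ∀ t ∈ Icc (0 : ℝ) 1, ∫⁻ x, ‖expWeight lam w t x‖ₑ ^ r ≤ B := by
  have hc : Continuous fun p : ℝ × ℝ => Real.exp (lam * p.1) * w p := by fun_prop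
  obtain ⟨C, hC⟩ := (isCompact_Icc.prod isCompact_Icc :
    IsCompact (Icc (-R) R ×ˢ Icc (0 : ℝ) 1)).exists_bound_of_continuousOn hc.continuousOn
  refine ⟨ENNReal.ofReal C ^ r * volume (Icc (-R) R), ENNReal.mul_ne_top
    (ENNReal.rpow_ne_top_of_nonneg hr.le ENNReal.ofReal_ne_top) (by simp), fun t ht => ?_⟩
  rw [← lintegral_indicator_const measurableSet_Icc]
  refine lintegral_mono fun x => ?_
  by_cases hx : x ∈ Icc (-R) R
  · rw [indicator_of_mem hx, expWeight, ← ofReal_norm, Complex.norm_real]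
    exact ENNReal.rpow_le_rpow (ENNReal.ofReal_le_ofReal (hC (x, t) ⟨hx, ht⟩)) hr.le
  · rw [indicator_of_notMem hx, expWeight_eq_zero lam h0 t x, enorm_zero,
      ENNReal.zero_rpow_of_pos hr]
    by_contra! hle
    exact hx (abs_le.1 hle)

theorem ofReal_div_sq_rpow_eq_rieszKernel {K s : ℝ} (hK : 0 < K) (hs : s ≠ 0) :
    ENNReal.ofReal (K ^ 8 / s ^ 2) ^ (1 / 8 : ℝ) = ENNReal.ofReal K * rieszKernel s := by
  have hs' : 0 < |s| := abs_pos.2 hs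
  rw [rieszKernel, ← ENNReal.ofReal_mul hK.le,
    ENNReal.ofReal_rpow_of_nonneg (by positivity) (by norm_num)]
  congr 1
  rw [← sq_abs, Real.div_rpow (by positivity) (by positivity), Real.rpow_neg hs'.le,
    ← Real.rpow_natCast K, ← Real.rpow_mul hK.le, ← Real.rpow_natCast |s|,
    ← Real.rpow_mul hs'.le, div_eq_mul_inv]
  norm_num

theorem measurable_enorm_expWeight (lam : ℝ) {w : ℝ × ℝ → ℝ} (hw : Continuous w) :
    Measurable fun p : ℝ × ℝ => ‖expWeight lam w p.1 p.2‖ₑ := by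
  have : Continuous fun p : ℝ × ℝ => expWeight lam w p.1 p.2 := by
    unfold expWeight; fun_prop
  exact this.enorm.measurable

theorem SpatiallyCompact.lintegral_expWeight_le {v v₁ v₂ v₃ vt : ℝ × ℝ → ℝ} {R : ℝ}
    (h : SpatiallyCompact v v₁ v₂ v₃ vt R) (hv0 : ∀ x, v (x, 0) = 0) (hv1 : ∀ x, v (x, 1) = 0)
    {lam : ℝ} (hlam : lam ≠ 0) :
    ∫⁻ t in Icc (0 : ℝ) 1, ∫⁻ x, ‖expWeight lam v t x‖ₑ ^ 8 ≤
      ENNReal.ofReal (14 ^ 8) * ENNReal.ofReal (2 * 10 ^ 8) *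
        (∫⁻ t in Icc (0 : ℝ) 1, ∫⁻ x,
          ‖expWeight lam (fun p => vt p + v₃ p) t x‖ₑ ^ (8 / 7 : ℝ)) ^ 7 := by
  set w : ℝ × ℝ → ℝ := fun p => vt p + v₃ p with hw
  have hwc : Continuous w := h.contt.add h.cont₃
  have hw0 : ∀ x t, R < |x| → w (x, t) = 0 := fun x t hx => by
    simp [hw, h.suppt x t hx, h.supp₃ x t hx]
  set A : ℝ → ℝ≥0∞ := fun t => ∫⁻ x, ‖expWeight lam v t x‖ₑ ^ 8 with hA
  set N : ℝ → ℝ≥0∞ := fun s => ∫⁻ x, ‖expWeight lam w s x‖ₑ ^ (8 / 7 : ℝ) with hN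
  have hAm : Measurable A :=
    ((measurable_enorm_expWeight lam h.cont).pow_const 8).lintegral_prod_right'
  have hNm : Measurable N :=
    ((measurable_enorm_expWeight lam hwc).pow_const (8 / 7 : ℝ)).lintegral_prod_right'
  obtain ⟨BA, hBA, hAB⟩ := exists_lintegral_expWeight_rpow_le lam h.cont h.supp (r := (8 : ℕ))
    (by norm_num)
  simp only [ENNReal.rpow_natCast] at hAB
  obtain ⟨BN, hBN, hNB⟩ := exists_lintegral_expWeight_rpow_le lam hwc hw0 (r := 8 / 7)
    (by norm_num)
  have hAfin : ∀ t ∈ Icc (0 : ℝ) 1, A t ≠ ∞ := fun t ht => ne_top_of_le_ne_top hBA (hAB t ht)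
  have h14 : ENNReal.ofReal 14 ≠ 0 := by simp
  have h14' : ENNReal.ofReal 14 ≠ ∞ := ENNReal.ofReal_ne_top
  have hest : ∀ t ∈ Icc (0 : ℝ) 1, A t ^ (1 / 8 : ℝ) ≤
      ENNReal.ofReal 14 * ∫⁻ s in Icc (0 : ℝ) 1, rieszKernel (t - s) * N s ^ (7 / 8 : ℝ) := by
    intro t ht
    have hne : ∀ᵐ s : ℝ ∂(volume.restrict (Icc (0 : ℝ) 1)), s ≠ t :=
      ae_restrict_of_ae (by simp [ae_iff])
    refine (lintegral_pow_eight_rpow_le (continuous_expWeight lam h.cont t).enorm.measurable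
      (measurable_fourierMul_airySymbol lam t hwc).enorm
      (fun x => h.enorm_expWeight_le hv0 hv1 hlam ht x) (hAfin t ht)).trans ?_
    rw [← lintegral_const_mul' _ _ h14']
    refine lintegral_mono_ae (hne.mono fun s hs => ?_)
    have hts : t - s ≠ 0 := sub_ne_zero.2 hs.symm
    have hF := continuous_expWeight lam hwc s
    have hF0 := expWeight_eq_zero lam hw0 s
    have hS := lintegral_airy_pow_eight_le hlam hts hF.measurable
      (integrable_of_forall_lt_abs hF hF0) (memLp_two_of_forall_lt_abs hF hF0)
    calc _ ≤ (ENNReal.ofReal (14 ^ 8 / (t - s) ^ 2) * N s ^ 7) ^ (1 / 8 : ℝ) := by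
          refine ENNReal.rpow_le_rpow (hS.trans ?_) (by norm_num)
          gcongr
          norm_num
      _ = _ := by
          rw [ENNReal.mul_rpow_of_nonneg _ _ (by norm_num),
            ofReal_div_sq_rpow_eq_rieszKernel (by norm_num) hts, mul_assoc,
            ← ENNReal.rpow_natCast, ← ENNReal.rpow_mul]
          norm_num
  have hNi : ∫⁻ s, (Icc (0 : ℝ) 1).indicator N s = ∫⁻ s in Icc (0 : ℝ) 1, N s :=
    lintegral_indicator measurableSet_Icc _
  have key := lintegral_pow_eight_le_of_le_lintegral_rieszKernel
    (f := (Icc (0 : ℝ) 1).indicator fun t => A t ^ (1 / 8 : ℝ) / ENNReal.ofReal 14)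
    (N := (Icc (0 : ℝ) 1).indicator N)
    (((hAm.pow_const _).div_const _).indicator measurableSet_Icc)
    (fun t => by
      by_cases ht : t ∈ Icc (0 : ℝ) 1
      · rw [indicator_of_mem ht]
        exact ENNReal.div_ne_top (ENNReal.rpow_ne_top_of_nonneg (by norm_num) (hAfin t ht)) h14
      · simp [indicator_of_notMem ht])
    (hNm.indicator measurableSet_Icc)
    (fun s => by
      by_cases hs : s ∈ Icc (0 : ℝ) 1
      · rw [indicator_of_mem hs]
        exact ne_top_of_le_ne_top hBN (hNB s hs)
      · simp [indicator_of_notMem hs])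
    (by
      rw [hNi]
      refine ne_top_of_le_ne_top (b := ∫⁻ s in Icc (0 : ℝ) 1, BN) ?_
        (setLIntegral_mono measurable_const hNB)
      simpa using hBN)
    (fun t => by
      by_cases ht : t ∈ Icc (0 : ℝ) 1
      · rw [indicator_of_mem ht]
        refine ENNReal.div_le_of_le_mul' ((hest t ht).trans (le_of_eq ?_))
        rw [← lintegral_indicator measurableSet_Icc]
        congr 1
        refine lintegral_congr fun s => ?_
        by_cases hs : s ∈ Icc (0 : ℝ) 1
        · simp only [indicator_of_mem hs]
        · simp only [indicator_of_notMem hs]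
          rw [ENNReal.zero_rpow_of_pos (by norm_num), mul_zero]
      · rw [indicator_of_notMem ht]
        exact zero_le)
  have hleft : ∫⁻ t, (Icc (0 : ℝ) 1).indicator
      (fun t => A t ^ (1 / 8 : ℝ) / ENNReal.ofReal 14) t ^ 8 =
      (∫⁻ t in Icc (0 : ℝ) 1, A t) / ENNReal.ofReal (14 ^ 8) := by
    rw [div_eq_mul_inv (∫⁻ t in Icc (0 : ℝ) 1, A t),
      ← lintegral_mul_const' _ _ (ENNReal.inv_ne_top.2 (by simp)),
      ← lintegral_indicator measurableSet_Icc]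
    refine lintegral_congr fun t => ?_
    by_cases ht : t ∈ Icc (0 : ℝ) 1
    · simp only [indicator_of_mem ht]
      rw [div_eq_mul_inv, mul_pow, ← ENNReal.rpow_natCast, ← ENNReal.rpow_mul, ← ENNReal.inv_pow,
        ENNReal.ofReal_pow (by norm_num)]
      norm_num
    · simp [indicator_of_notMem ht]
  rw [hleft, hNi] at key
  rw [mul_assoc]
  exact (ENNReal.div_le_iff_le_mul (Or.inl (by simp)) (Or.inl ENNReal.ofReal_ne_top)).1 key |>.trans
    (le_of_eq (mul_comm _ _))

end MixedNorm

section Strip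
open Set
open scoped ENNReal

theorem restrict_univ_prod_Icc : (volume : Measure (ℝ × ℝ)).restrict (univ ×ˢ Icc (0 : ℝ) 1) =
    (volume : Measure ℝ).prod (volume.restrict (Icc (0 : ℝ) 1)) := by
  rw [Measure.volume_eq_prod, ← Measure.prod_restrict, Measure.restrict_univ]

theorem eLpNorm_strip_rpow {f : ℝ × ℝ → ℝ} (hf : Measurable f) {p : ℝ} (hp : 0 < p) :
    eLpNorm f (ENNReal.ofReal p) (volume.restrict (univ ×ˢ Icc (0 : ℝ) 1)) ^ p =
      ∫⁻ t in Icc (0 : ℝ) 1, ∫⁻ x, ‖f (x, t)‖ₑ ^ p := by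
  have hp' : ENNReal.ofReal p ≠ 0 := by simpa using hp
  rw [eLpNorm_eq_lintegral_rpow_enorm_toReal hp' ENNReal.ofReal_ne_top,
    ENNReal.toReal_ofReal hp.le, ← ENNReal.rpow_mul, one_div_mul_cancel hp.ne', ENNReal.rpow_one,
    restrict_univ_prod_Icc, lintegral_prod_symm _ (hf.enorm.pow_const p).aemeasurable]

theorem SpatiallyCompact.eLpNorm_le_of_ne_zero {v v₁ v₂ v₃ vt : ℝ × ℝ → ℝ} {R : ℝ}
    (h : SpatiallyCompact v v₁ v₂ v₃ vt R) (hv0 : ∀ x, v (x, 0) = 0) (hv1 : ∀ x, v (x, 1) = 0)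
    {lam : ℝ} (hlam : lam ≠ 0) :
    eLpNorm (fun p => Real.exp (lam * p.1) * v p) 8 (volume.restrict (univ ×ˢ Icc (0 : ℝ) 1)) ≤
      ENNReal.ofReal 154 * eLpNorm (fun p => Real.exp (lam * p.1) * (vt p + v₃ p)) (8 / 7)
        (volume.restrict (univ ×ˢ Icc (0 : ℝ) 1)) := by
  have hc : Continuous fun p : ℝ × ℝ => Real.exp (lam * p.1) * v p := by
    have := h.cont; fun_prop
  have hc' : Continuous fun p : ℝ × ℝ => Real.exp (lam * p.1) * (vt p + v₃ p) := by
    have := h.cont₃; have := h.contt; fun_prop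
  have e8 : ENNReal.ofReal (8 : ℝ) = 8 := by norm_num
  have e87 : ENNReal.ofReal (8 / 7 : ℝ) = 8 / 7 := by
    rw [ENNReal.ofReal_div_of_pos (by norm_num)]; norm_num
  have l8 := eLpNorm_strip_rpow hc.measurable (p := 8) (by norm_num)
  have l87 := eLpNorm_strip_rpow hc'.measurable (p := 8 / 7) (by norm_num)
  rw [e8] at l8
  rw [e87] at l87
  have key := h.lintegral_expWeight_le hv0 hv1 hlam
  have henorm : ∀ (w : ℝ × ℝ → ℝ) (t x : ℝ),
      ‖expWeight lam w t x‖ₑ = ‖Real.exp (lam * x) * w (x, t)‖ₑ := fun w t x => by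
    rw [expWeight, ← ofReal_norm, Complex.norm_real, ofReal_norm]
  have hpow : ∀ a : ℝ≥0∞, a ^ (8 : ℝ) = a ^ 8 := fun a => by
    rw [← ENNReal.rpow_natCast]; norm_num
  simp only [henorm] at key
  simp only [hpow] at l8
  rw [← l8, ← l87] at key
  refine (ENNReal.rpow_le_rpow_iff (z := 8) (by norm_num)).1 ?_
  rw [hpow, hpow, mul_pow]
  refine key.trans ?_
  rw [← ENNReal.rpow_natCast, ← ENNReal.rpow_mul, ← ENNReal.ofReal_mul (by norm_num),
    ← ENNReal.ofReal_pow (by norm_num), ← hpow]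
  norm_num
  gcongr
  norm_num

end Strip

section Truncation
open Set Filter
open scoped ENNReal Topology

theorem SpatiallyCompact.eLpNorm_le {v v₁ v₂ v₃ vt : ℝ × ℝ → ℝ} {R : ℝ}
    (h : SpatiallyCompact v v₁ v₂ v₃ vt R) (hv0 : ∀ x, v (x, 0) = 0) (hv1 : ∀ x, v (x, 1) = 0)
    (lam : ℝ) :
    eLpNorm (fun p => Real.exp (lam * p.1) * v p) 8 (volume.restrict (univ ×ˢ Icc (0 : ℝ) 1)) ≤
      ENNReal.ofReal 616 * eLpNorm (fun p => Real.exp (lam * p.1) * (vt p + v₃ p)) (8 / 7)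
        (volume.restrict (univ ×ˢ Icc (0 : ℝ) 1)) := by
  rcases eq_or_ne lam 0 with rfl | hlam
  · set μ : ℝ := Real.log 2 / (|R| + 1) with hμ
    have hlog : 0 < Real.log 2 := Real.log_pos (by norm_num)
    have hμ0 : 0 < μ := by positivity
    have hexp : ∀ x : ℝ, |x| ≤ R → Real.exp (μ * x) ≤ 2 ∧ 1 ≤ 2 * Real.exp (μ * x) := by
      intro x hx
      have h1 : |μ * x| ≤ Real.log 2 := by
        rw [abs_mul, abs_of_pos hμ0, hμ, div_mul_eq_mul_div, div_le_iff₀ (by positivity)]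
        exact mul_le_mul_of_nonneg_left (by linarith [le_abs_self R]) hlog.le
      have h2 := abs_le.1 h1
      constructor
      · rw [← Real.le_log_iff_exp_le (by norm_num)]
        exact h2.2
      · have := Real.exp_le_exp.2 h2.1
        rw [Real.exp_neg, Real.exp_log (by norm_num)] at this
        linarith
    have hleft : eLpNorm (fun p => Real.exp (0 * p.1) * v p) 8
        (volume.restrict (univ ×ˢ Icc (0 : ℝ) 1)) ≤ ENNReal.ofReal 2 *
        eLpNorm (fun p => Real.exp (μ * p.1) * v p) 8
          (volume.restrict (univ ×ˢ Icc (0 : ℝ) 1)) := by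
      refine eLpNorm_le_mul_eLpNorm_of_ae_le_mul (Eventually.of_forall fun p => ?_) 8
      rcases lt_or_ge R |p.1| with hp | hp
      · simp [show v p = 0 from h.supp p.1 p.2 hp]
      · rw [zero_mul, Real.exp_zero, one_mul, norm_mul, Real.norm_eq_abs (Real.exp _), Real.abs_exp,
          ← mul_assoc]
        exact le_mul_of_one_le_left (norm_nonneg _) (hexp _ hp).2
    have hright : eLpNorm (fun p => Real.exp (μ * p.1) * (vt p + v₃ p)) (8 / 7)
        (volume.restrict (univ ×ˢ Icc (0 : ℝ) 1)) ≤ ENNReal.ofReal 2 *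
        eLpNorm (fun p => Real.exp (0 * p.1) * (vt p + v₃ p)) (8 / 7)
          (volume.restrict (univ ×ˢ Icc (0 : ℝ) 1)) := by
      refine eLpNorm_le_mul_eLpNorm_of_ae_le_mul (Eventually.of_forall fun p => ?_) _
      rcases lt_or_ge R |p.1| with hp | hp
      · simp [show vt p = 0 from h.suppt p.1 p.2 hp, show v₃ p = 0 from h.supp₃ p.1 p.2 hp]
      · rw [zero_mul, Real.exp_zero, one_mul, norm_mul, Real.norm_eq_abs (Real.exp _), Real.abs_exp]
        exact mul_le_mul_of_nonneg_right (hexp _ hp).1 (norm_nonneg _)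
    refine hleft.trans ((mul_le_mul_right ((h.eLpNorm_le_of_ne_zero hv0 hv1 hμ0.ne').trans
      (mul_le_mul_right hright _)) _).trans (le_of_eq ?_))
    rw [← mul_assoc, ← mul_assoc, ← ENNReal.ofReal_mul (by norm_num),
      ← ENNReal.ofReal_mul (by norm_num)]
    norm_num
  · refine (h.eLpNorm_le_of_ne_zero hv0 hv1 hlam).trans ?_
    gcongr
    norm_num

/-- A smooth cutoff together with its first three derivatives. -/
structure CutoffFamily (φ φ₁ φ₂ φ₃ : ℝ → ℝ) (B : ℝ) : Prop where
  deriv₁ : ∀ x, HasDerivAt φ (φ₁ x) x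
  deriv₂ : ∀ x, HasDerivAt φ₁ (φ₂ x) x
  deriv₃ : ∀ x, HasDerivAt φ₂ (φ₃ x) x
  cont₃ : Continuous φ₃
  supp : ∀ x, 2 < |x| → φ x = 0
  apply_zero : φ 0 = 1
  abs_le_one : ∀ x, |φ x| ≤ 1
  bound₁ : ∀ x, |φ₁ x| ≤ B
  bound₂ : ∀ x, |φ₂ x| ≤ B
  bound₃ : ∀ x, |φ₃ x| ≤ B

theorem exists_cutoffFamily : ∃ φ φ₁ φ₂ φ₃ B, CutoffFamily φ φ₁ φ₂ φ₃ B := by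
  let b : ContDiffBump (0 : ℝ) := ⟨1, 2, one_pos, one_lt_two⟩
  have h0 : ContDiff ℝ 3 b := b.contDiff
  have h1 : ContDiff ℝ 2 (deriv b) := ((contDiff_succ_iff_deriv (n := 2)).1 h0).2.2
  have h2 : ContDiff ℝ 1 (deriv (deriv b)) := ((contDiff_succ_iff_deriv (n := 1)).1 h1).2.2
  have h3 : Continuous (deriv (deriv (deriv b))) := h2.continuous_deriv le_rfl
  have hd1 : ∀ x, HasDerivAt b (deriv b x) x := fun x =>
    (h0.differentiable (by norm_num) x).hasDerivAt
  have hd2 : ∀ x, HasDerivAt (deriv b) (deriv (deriv b) x) x := fun x =>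
    (h1.differentiable (by norm_num) x).hasDerivAt
  have hd3 : ∀ x, HasDerivAt (deriv (deriv b)) (deriv (deriv (deriv b)) x) x := fun x =>
    (h2.differentiable (by norm_num) x).hasDerivAt
  have hs0 : ∀ x, 2 < |x| → b x = 0 := fun x hx => b.zero_of_le_dist (by simpa using hx.le)
  have hs1 : ∀ x, 2 < |x| → deriv b x = 0 := fun x => (hd1 x).eq_zero_of_forall_lt_abs hs0
  have hs2 : ∀ x, 2 < |x| → deriv (deriv b) x = 0 := fun x =>
    (hd2 x).eq_zero_of_forall_lt_abs hs1
  have hs3 : ∀ x, 2 < |x| → deriv (deriv (deriv b)) x = 0 := fun x =>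
    (hd3 x).eq_zero_of_forall_lt_abs hs2
  have hb : ∀ f : ℝ → ℝ, Continuous f → (∀ x, 2 < |x| → f x = 0) → ∃ C, ∀ x, |f x| ≤ C := by
    intro f hf hf0
    obtain ⟨C, hC⟩ := (isCompact_Icc (a := (-2 : ℝ)) (b := 2)).exists_bound_of_continuousOn
      hf.continuousOn
    refine ⟨|C|, fun x => ?_⟩
    rcases lt_or_ge 2 |x| with hx | hx
    · simp [hf0 x hx]
    · exact (hC x (abs_le.1 hx)).trans (le_abs_self C)
  obtain ⟨C₁, hC₁⟩ := hb _ h1.continuous hs1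
  obtain ⟨C₂, hC₂⟩ := hb _ h2.continuous hs2
  obtain ⟨C₃, hC₃⟩ := hb _ h3 hs3
  refine ⟨b, deriv b, deriv (deriv b), deriv (deriv (deriv b)), max C₁ (max C₂ C₃),
    hd1, hd2, hd3, h3, hs0, b.one_of_mem_closedBall (by simp [b]), fun x => ?_,
    fun x => (hC₁ x).trans (le_max_left _ _),
    fun x => (hC₂ x).trans ((le_max_left _ _).trans (le_max_right _ _)),
    fun x => (hC₃ x).trans ((le_max_right _ _).trans (le_max_right _ _))⟩
  rw [abs_of_nonneg b.nonneg]
  exact b.le_one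

theorem C31.hasDerivAt {g : ℝ × ℝ → ℝ} (hg : C31 g) (x t : ℝ) :
    HasDerivAt (fun x => g (x, t)) (pdx g (x, t)) x :=
  ((hg.1 t).differentiable (by norm_num) x).hasDerivAt

theorem C31.contDiff_pdx {g : ℝ × ℝ → ℝ} (hg : C31 g) (t : ℝ) :
    ContDiff ℝ 2 fun x => pdx g (x, t) :=
  ((contDiff_succ_iff_deriv (n := 2)).1 (hg.1 t)).2.2

theorem C31.contDiff_pdx_pdx {g : ℝ × ℝ → ℝ} (hg : C31 g) (t : ℝ) :
    ContDiff ℝ 1 fun x => pdx (pdx g) (x, t) :=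
  ((contDiff_succ_iff_deriv (n := 1)).1 (hg.contDiff_pdx t)).2.2

theorem C31.hasDerivAt_pdx {g : ℝ × ℝ → ℝ} (hg : C31 g) (x t : ℝ) :
    HasDerivAt (fun x => pdx g (x, t)) (pdx (pdx g) (x, t)) x :=
  ((hg.contDiff_pdx t).differentiable (by norm_num) x).hasDerivAt

theorem C31.hasDerivAt_pdx_pdx {g : ℝ × ℝ → ℝ} (hg : C31 g) (x t : ℝ) :
    HasDerivAt (fun x => pdx (pdx g) (x, t)) (pdx (pdx (pdx g)) (x, t)) x :=
  ((hg.contDiff_pdx_pdx t).differentiable (by norm_num) x).hasDerivAt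

theorem CutoffFamily.spatiallyCompact {φ φ₁ φ₂ φ₃ : ℝ → ℝ} {B : ℝ}
    (hφ : CutoffFamily φ φ₁ φ₂ φ₃ B) {g : ℝ × ℝ → ℝ} (hg : C31 g) {ε : ℝ} (hε : 0 < ε) :
    SpatiallyCompact (fun p => φ (ε * p.1) * g p)
      (fun p => ε * φ₁ (ε * p.1) * g p + φ (ε * p.1) * pdx g p)
      (fun p => ε ^ 2 * φ₂ (ε * p.1) * g p + 2 * ε * φ₁ (ε * p.1) * pdx g p +
        φ (ε * p.1) * pdx (pdx g) p)
      (fun p => ε ^ 3 * φ₃ (ε * p.1) * g p + 3 * ε ^ 2 * φ₂ (ε * p.1) * pdx g p +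
        3 * ε * φ₁ (ε * p.1) * pdx (pdx g) p + φ (ε * p.1) * pdx (pdx (pdx g)) p)
      (fun p => φ (ε * p.1) * pdt g p) (2 / ε) := by
  have hg' := hg
  obtain ⟨-, hdt, hc, hc₁, hc₂, hc₃, hct⟩ := hg'
  have k0 : Continuous φ := continuous_iff_continuousAt.2 fun x => (hφ.deriv₁ x).continuousAt
  have k1 : Continuous φ₁ := continuous_iff_continuousAt.2 fun x => (hφ.deriv₂ x).continuousAt
  have k2 : Continuous φ₂ := continuous_iff_continuousAt.2 fun x => (hφ.deriv₃ x).continuousAt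
  have k3 := hφ.cont₃
  have hlin : ∀ x : ℝ, HasDerivAt (fun x => ε * x) ε x := fun x => by
    simpa using (hasDerivAt_id x).const_mul ε
  have d1 : ∀ x, HasDerivAt (fun x => φ (ε * x)) (φ₁ (ε * x) * ε) x := fun x =>
    (hφ.deriv₁ (ε * x)).comp x (hlin x)
  have d2 : ∀ x, HasDerivAt (fun x => φ₁ (ε * x)) (φ₂ (ε * x) * ε) x := fun x =>
    (hφ.deriv₂ (ε * x)).comp x (hlin x)
  have d3 : ∀ x, HasDerivAt (fun x => φ₂ (ε * x)) (φ₃ (ε * x) * ε) x := fun x =>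
    (hφ.deriv₃ (ε * x)).comp x (hlin x)
  refine ⟨by fun_prop, by fun_prop, by fun_prop, by fun_prop, by fun_prop, fun x t => ?_,
    fun x t => ?_, fun x t => ?_, fun x t => ?_, fun x t hx => ?_⟩
  · refine ((d1 x).fun_mul (hg.hasDerivAt x t)).congr_deriv ?_
    ring
  · refine ((((d2 x).const_mul ε).fun_mul (hg.hasDerivAt x t)).fun_add
      ((d1 x).fun_mul (hg.hasDerivAt_pdx x t))).congr_deriv ?_
    ring
  · refine (((((d3 x).const_mul (ε ^ 2)).fun_mul (hg.hasDerivAt x t)).fun_add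
      (((d2 x).const_mul (2 * ε)).fun_mul (hg.hasDerivAt_pdx x t))).fun_add
      ((d1 x).fun_mul (hg.hasDerivAt_pdx_pdx x t))).congr_deriv ?_
    ring
  · exact (hdt x t).hasDerivAt.const_mul (φ (ε * x))
  · rw [hφ.supp (ε * x), zero_mul]
    rwa [abs_mul, abs_of_pos hε, ← div_lt_iff₀' hε]

theorem eLpNorm_exp_neg_abs_ne_top :
    eLpNorm (fun p : ℝ × ℝ => Real.exp (-|p.1|)) (8 / 7)
      (volume.restrict (univ ×ˢ Icc (0 : ℝ) 1)) ≠ ∞ := by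
  have e87 : ENNReal.ofReal (8 / 7 : ℝ) = 8 / 7 := by
    rw [ENNReal.ofReal_div_of_pos (by norm_num)]; norm_num
  have hc : Continuous fun p : ℝ × ℝ => Real.exp (-|p.1|) := by fun_prop
  have h := eLpNorm_strip_rpow hc.measurable (p := 8 / 7) (by norm_num)
  rw [e87] at h
  have hpoint : ∫⁻ x : ℝ, ‖Real.exp (-|x|)‖ₑ ^ (8 / 7 : ℝ) < ∞ := by
    refine lt_of_le_of_lt (lintegral_mono fun x => ?_) (integrable_inv_one_add_sq.const_mul 2).2
    have hx : Real.exp (-|x|) ≤ 2 * (1 + x ^ 2)⁻¹ := by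
      rw [Real.exp_neg, inv_le_comm₀ (Real.exp_pos _) (by positivity), mul_inv, inv_inv]
      have := Real.quadratic_le_exp_of_nonneg (abs_nonneg x)
      rw [sq_abs] at this
      linarith [abs_nonneg x]
    have h1 : ‖Real.exp (-|x|)‖ₑ ≤ 1 := by
      rw [Real.enorm_of_nonneg (Real.exp_pos _).le]
      simp
    calc ‖Real.exp (-|x|)‖ₑ ^ (8 / 7 : ℝ) ≤ ‖Real.exp (-|x|)‖ₑ :=
          ENNReal.rpow_le_self_of_le_one h1 (by norm_num)
      _ ≤ _ := by
          rw [Real.enorm_of_nonneg (Real.exp_pos _).le, Real.enorm_of_nonneg (by positivity)]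
          exact ENNReal.ofReal_le_ofReal hx
  intro htop
  rw [htop, ENNReal.top_rpow_of_pos (by norm_num)] at h
  simp only [lintegral_const, Measure.restrict_apply MeasurableSet.univ, univ_inter, Real.volume_Icc,
    sub_zero,
    ENNReal.ofReal_one, mul_one] at h
  exact hpoint.ne h.symm

theorem CutoffFamily.eLpNorm_truncation_le {φ φ₁ φ₂ φ₃ : ℝ → ℝ} {B : ℝ}
    (hφ : CutoffFamily φ φ₁ φ₂ φ₃ B) {g : ℝ × ℝ → ℝ} (hg : C31 g) {lam c : ℝ}
    (hgc : ∀ x : ℝ, ∀ t ∈ Icc (0 : ℝ) 1,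
      |g (x, t)| + |pdx g (x, t)| + |pdx (pdx g) (x, t)| ≤ c * Real.exp (-(|lam| + 1) * |x|))
    {ε : ℝ} (hε : 0 < ε) (hε1 : ε ≤ 1) :
    eLpNorm (fun p => Real.exp (lam * p.1) * (φ (ε * p.1) * pdt g p +
        (ε ^ 3 * φ₃ (ε * p.1) * g p + 3 * ε ^ 2 * φ₂ (ε * p.1) * pdx g p +
          3 * ε * φ₁ (ε * p.1) * pdx (pdx g) p + φ (ε * p.1) * pdx (pdx (pdx g)) p))) (8 / 7)
        (volume.restrict (univ ×ˢ Icc (0 : ℝ) 1)) ≤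
      eLpNorm (fun p => Real.exp (lam * p.1) * (pdt g p + pdx (pdx (pdx g)) p)) (8 / 7)
          (volume.restrict (univ ×ˢ Icc (0 : ℝ) 1)) +
        ENNReal.ofReal (ε * (3 * B * c)) * eLpNorm (fun p : ℝ × ℝ => Real.exp (-|p.1|)) (8 / 7)
          (volume.restrict (univ ×ˢ Icc (0 : ℝ) 1)) := by
  obtain ⟨-, -, hc, hc₁, hc₂, hc₃, hct⟩ := id hg
  have k0 : Continuous φ := continuous_iff_continuousAt.2 fun x => (hφ.deriv₁ x).continuousAt
  have k1 : Continuous φ₁ := continuous_iff_continuousAt.2 fun x => (hφ.deriv₂ x).continuousAt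
  have k2 : Continuous φ₂ := continuous_iff_continuousAt.2 fun x => (hφ.deriv₃ x).continuousAt
  have k3 := hφ.cont₃
  have hB : 0 ≤ B := (abs_nonneg _).trans (hφ.bound₁ 0)
  set f₁ : ℝ × ℝ → ℝ := fun p =>
    Real.exp (lam * p.1) * (φ (ε * p.1) * (pdt g p + pdx (pdx (pdx g)) p)) with hf₁
  set f₂ : ℝ × ℝ → ℝ := fun p => Real.exp (lam * p.1) * (ε ^ 3 * φ₃ (ε * p.1) * g p +
    3 * ε ^ 2 * φ₂ (ε * p.1) * pdx g p + 3 * ε * φ₁ (ε * p.1) * pdx (pdx g) p) with hf₂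
  have hf₁c : Continuous f₁ := by fun_prop
  have hf₂c : Continuous f₂ := by fun_prop
  have hone : (1 : ℝ≥0∞) ≤ 8 / 7 := by
    rw [ENNReal.le_div_iff_mul_le (by simp) (by simp)]; norm_num
  calc _ = eLpNorm (f₁ + f₂) (8 / 7) (volume.restrict (univ ×ˢ Icc (0 : ℝ) 1)) := by
        congr 1; ext p; simp only [hf₁, hf₂, Pi.add_apply]; ring
    _ ≤ _ := eLpNorm_add_le hf₁c.aestronglyMeasurable hf₂c.aestronglyMeasurable hone
    _ ≤ _ := by
        refine add_le_add (eLpNorm_mono fun p => ?_) ?_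
        · rw [hf₁, norm_mul, norm_mul, norm_mul]
          exact mul_le_mul_of_nonneg_left
            (mul_le_of_le_one_left (norm_nonneg _) (hφ.abs_le_one _)) (norm_nonneg _)
        · refine eLpNorm_le_mul_eLpNorm_of_ae_le_mul ?_ _
          filter_upwards [ae_restrict_mem (MeasurableSet.univ.prod measurableSet_Icc)] with p hp
          have hgp := hgc p.1 p.2 hp.2
          have hexp : Real.exp (lam * p.1) * Real.exp (-(|lam| + 1) * |p.1|) ≤
              Real.exp (-|p.1|) := by
            rw [← Real.exp_add]
            refine Real.exp_le_exp.2 ?_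
            have := le_abs_self (lam * p.1)
            rw [abs_mul] at this
            linarith
          have hε2 : ε ^ 2 ≤ ε := by nlinarith
          have hε3 : ε ^ 3 ≤ ε := by nlinarith
          have b1 : |ε ^ 3 * φ₃ (ε * p.1) * g p| ≤ ε * (3 * B) * |g p| := by
            rw [abs_mul, abs_mul, abs_of_pos (pow_pos hε 3)]
            gcongr
            linarith [hφ.bound₃ (ε * p.1)]
          have b2 : |3 * ε ^ 2 * φ₂ (ε * p.1) * pdx g p| ≤ ε * (3 * B) * |pdx g p| := by
            rw [abs_mul, abs_mul, abs_of_pos (by positivity : 0 < 3 * ε ^ 2)]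
            have : 3 * ε ^ 2 * |φ₂ (ε * p.1)| ≤ 3 * ε * B := by
              gcongr
              exact hφ.bound₂ _
            exact mul_le_mul_of_nonneg_right (by linarith) (abs_nonneg _)
          have b3 : |3 * ε * φ₁ (ε * p.1) * pdx (pdx g) p| ≤ ε * (3 * B) * |pdx (pdx g) p| := by
            rw [abs_mul, abs_mul, abs_of_pos (by positivity : 0 < 3 * ε)]
            have : 3 * ε * |φ₁ (ε * p.1)| ≤ 3 * ε * B := by
              gcongr
              exact hφ.bound₁ _
            exact mul_le_mul_of_nonneg_right (by linarith) (abs_nonneg _)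
          rw [hf₂, norm_mul, Real.norm_eq_abs, Real.norm_eq_abs, Real.norm_eq_abs, Real.abs_exp,
            Real.abs_exp]
          have hsum := (abs_add_three _ _ _).trans (add_le_add (add_le_add b1 b2) b3)
          have hcn : 0 ≤ c := by
            by_contra! hneg
            have := mul_neg_of_neg_of_pos hneg (Real.exp_pos (-(|lam| + 1) * |p.1|))
            linarith [abs_nonneg (g (p.1, p.2)), abs_nonneg (pdx g (p.1, p.2)),
              abs_nonneg (pdx (pdx g) (p.1, p.2))]
          calc _ ≤ Real.exp (lam * p.1) *
                (ε * (3 * B) * (c * Real.exp (-(|lam| + 1) * |p.1|))) := by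
                refine mul_le_mul_of_nonneg_left (hsum.trans ?_) (Real.exp_pos _).le
                rw [← mul_add, ← mul_add]
                exact mul_le_mul_of_nonneg_left hgp (by positivity)
            _ = ε * (3 * B * c) *
                (Real.exp (lam * p.1) * Real.exp (-(|lam| + 1) * |p.1|)) := by ring
            _ ≤ _ := mul_le_mul_of_nonneg_left hexp (by positivity)

end Truncation

theorem stmt14 : ∃ c₀ : ℝ, 0 < c₀ ∧ ∀ g : ℝ × ℝ → ℝ, C31 g →
    (∀ β : ℝ, 0 < β → ∃ cβ : ℝ, ∀ x : ℝ, ∀ t ∈ Set.Icc (0:ℝ) 1,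
      |g (x, t)| + |pdx g (x, t)| + |pdx (pdx g) (x, t)| ≤ cβ * Real.exp (-β * |x|)) →
    (∀ x : ℝ, g (x, 0) = 0 ∧ g (x, 1) = 0) →
    ∀ lam : ℝ,
      eLpNorm (fun p => Real.exp (lam * p.1) * g p) 8
          (volume.restrict ((Set.univ : Set ℝ) ×ˢ Set.Icc (0:ℝ) 1)) ≤
        ENNReal.ofReal c₀ *
          eLpNorm (fun p => Real.exp (lam * p.1) * (pdt g p + pdx (pdx (pdx g)) p)) (8/7)
            (volume.restrict ((Set.univ : Set ℝ) ×ˢ Set.Icc (0:ℝ) 1)) := by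
  refine ⟨616, by norm_num, fun g hg hdecay hg0 lam => ?_⟩
  obtain ⟨c, hgc⟩ := hdecay (|lam| + 1) (by positivity)
  obtain ⟨φ, φ₁, φ₂, φ₃, B, hφ⟩ := exists_cutoffFamily
  have hφc : Continuous φ := continuous_iff_continuousAt.2 fun x => (hφ.deriv₁ x).continuousAt
  have hgcont : Continuous g := hg.2.2.1
  have hε : ∀ n : ℕ, (0 : ℝ) < 1 / ((n : ℝ) + 1) := fun n => by positivity
  have hε1 : ∀ n : ℕ, 1 / ((n : ℝ) + 1) ≤ 1 := fun n =>
    (div_le_one (by positivity)).2 (by linarith [(Nat.cast_nonneg n : (0 : ℝ) ≤ n)])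
  have hlim : Filter.Tendsto (fun n : ℕ => 1 / ((n : ℝ) + 1)) Filter.atTop (nhds 0) :=
    tendsto_one_div_add_atTop_nhds_zero_nat
  refine (Lp.eLpNorm_lim_le_liminf_eLpNorm
    (f := fun (n : ℕ) p => Real.exp (lam * p.1) * (φ (1 / ((n : ℝ) + 1) * p.1) * g p))
    (fun n => ?_) _ (Filter.Eventually.of_forall fun p => ?_)).trans ?_
  · exact (by fun_prop : Continuous fun p : ℝ × ℝ =>
      Real.exp (lam * p.1) * (φ (1 / ((n : ℝ) + 1) * p.1) * g p)).aestronglyMeasurable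
  · have h1 : Filter.Tendsto (fun n : ℕ => φ (1 / ((n : ℝ) + 1) * p.1)) Filter.atTop (nhds 1) := by
      have h2 := hlim.mul_const p.1
      rw [zero_mul] at h2
      have h3 := (hφc.tendsto 0).comp h2
      rwa [hφ.apply_zero] at h3
    simpa using (h1.mul_const (g p)).const_mul (Real.exp (lam * p.1))
  · have hR : Filter.Tendsto (fun n : ℕ => ENNReal.ofReal 616 *
        (eLpNorm (fun p => Real.exp (lam * p.1) * (pdt g p + pdx (pdx (pdx g)) p)) (8 / 7)
          (volume.restrict (Set.univ ×ˢ Set.Icc (0 : ℝ) 1)) +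
        ENNReal.ofReal (1 / ((n : ℝ) + 1) * (3 * B * c)) *
          eLpNorm (fun p : ℝ × ℝ => Real.exp (-|p.1|)) (8 / 7)
            (volume.restrict (Set.univ ×ˢ Set.Icc (0 : ℝ) 1)))) Filter.atTop
        (nhds (ENNReal.ofReal 616 *
          eLpNorm (fun p => Real.exp (lam * p.1) * (pdt g p + pdx (pdx (pdx g)) p)) (8 / 7)
            (volume.restrict (Set.univ ×ˢ Set.Icc (0 : ℝ) 1)))) := by
      refine ENNReal.Tendsto.const_mul ?_ (Or.inr ENNReal.ofReal_ne_top)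
      have h1 := ENNReal.tendsto_ofReal (hlim.mul_const (3 * B * c))
      have h2 := ENNReal.Tendsto.mul_const h1 (Or.inr eLpNorm_exp_neg_abs_ne_top)
      simpa using h2.const_add _
    rw [← hR.liminf_eq]
    refine Filter.liminf_le_liminf (Filter.Eventually.of_forall fun n => ?_)
    refine ((hφ.spatiallyCompact hg (hε n)).eLpNorm_le (fun x => by simp [(hg0 x).1])
      (fun x => by simp [(hg0 x).2]) lam).trans ?_
    exact mul_le_mul_right (hφ.eLpNorm_truncation_le hg hgc (hε n) (hε1 n)) _
end

section
/- Let P(z) = (z−1)^{2j+1} for j ∈ ℤ⁺, and define K₊(x,t) = 𝟙_{t≥0}(t) ∫ e^{ixξ − tP(iξ)} 𝟙_{Re P(iξ) ≥ 0}(ξ) dξ. Then there is a constant c = c(j) with |K₊(x,t)| ≤ c |t|^{−1/(2j+1)} for all (x,t) with t ≠ 0, and the analogous bound holds for K₋ (defined with t < 0 and Re P(iξ) < 0). -/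
open MeasureTheory

open Classical in
/-- The kernel `K₊(x,t) = 𝟙_{t≥0}(t) ∫ e^{ixξ - tP(iξ)} 𝟙_{Re P(iξ) ≥ 0}(ξ) dξ`
with `P(z) = (z-1)^{2j+1}`. -/
noncomputable def Kplus (j : ℕ) (x t : ℝ) : ℂ :=
  if 0 ≤ t then
    ∫ ξ : ℝ,
      if 0 ≤ ((Complex.I * (ξ : ℂ) - 1) ^ (2 * j + 1)).re then
        Complex.exp (Complex.I * (x : ℂ) * (ξ : ℂ) -
          (t : ℂ) * (Complex.I * (ξ : ℂ) - 1) ^ (2 * j + 1))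
      else 0
  else 0

open Classical in
/-- The kernel `K₋`, defined with `t < 0` and `Re P(iξ) < 0`. -/
noncomputable def Kminus (j : ℕ) (x t : ℝ) : ℂ :=
  if t < 0 then
    ∫ ξ : ℝ,
      if ((Complex.I * (ξ : ℂ) - 1) ^ (2 * j + 1)).re < 0 then
        Complex.exp (Complex.I * (x : ℂ) * (ξ : ℂ) -
          (t : ℂ) * (Complex.I * (ξ : ℂ) - 1) ^ (2 * j + 1))
      else 0
  else 0

/-- If `‖∫ f‖ ≤ C + ∫ g` on every interval whose interior avoids the finite set `S`, then on a
general interval the constant `C` is paid once for each of the pieces cut out by `S`. -/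
theorem norm_intervalIntegral_le_of_pieces {E : Type*} [NormedAddCommGroup E] [NormedSpace ℝ E]
    {f : ℝ → E} {g : ℝ → ℝ} {C : ℝ} (hf : Integrable f) (hg : Integrable g) (S : Finset ℝ)
    (h : ∀ a b, a ≤ b → (∀ s ∈ S, s ∉ Set.Ioo a b) →
      ‖∫ x in a..b, f x‖ ≤ C + ∫ x in a..b, g x) {a b : ℝ} (hab : a ≤ b) :
    ‖∫ x in a..b, f x‖ ≤ ((S.filter (· ∈ Set.Ioo a b)).card + 1) * C + ∫ x in a..b, g x := by
  classical
  induction hn : (S.filter (· ∈ Set.Ioo a b)).card using Nat.strong_induction_on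
    generalizing a b with
  | _ n ih =>
    obtain hS | ⟨s, hs⟩ := (S.filter (· ∈ Set.Ioo a b)).eq_empty_or_nonempty
    · have hn0 : n = 0 := by rw [← hn, hS, Finset.card_empty]
      simpa [hn0] using h a b hab fun s hs hsab ↦
        Finset.notMem_empty s (hS ▸ Finset.mem_filter.2 ⟨hs, hsab⟩)
    · obtain ⟨hsS, has, hsb⟩ := Finset.mem_filter.1 hs
      set L := S.filter (· ∈ Set.Ioo a s) with hL
      set R := S.filter (· ∈ Set.Ioo s b) with hR
      have hdisj : Disjoint L R := Finset.disjoint_left.2 fun x hx hx' ↦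
        lt_asymm (Finset.mem_filter.1 hx).2.2 (Finset.mem_filter.1 hx').2.1
      have hsLR : s ∉ L ∪ R := by simp [hL, hR]
      have hcard : L.card + R.card + 1 = n := by
        rw [← hn, ← Finset.card_union_of_disjoint hdisj, ← Finset.card_insert_of_notMem hsLR]
        congr 1
        ext x
        simp only [hL, hR, Finset.mem_insert, Finset.mem_union, Finset.mem_filter, Set.mem_Ioo]
        grind
      have h₁ := ih L.card (by omega) has.le rfl
      have h₂ := ih R.card (by omega) hsb.le rfl
      rw [← intervalIntegral.integral_add_adjacent_intervals (hf.intervalIntegrable (a := a))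
          (hf.intervalIntegrable (a := s)),
        ← intervalIntegral.integral_add_adjacent_intervals (hg.intervalIntegrable (a := a))
          (hg.intervalIntegrable (a := s))]
      refine (norm_add_le _ _).trans ((add_le_add h₁ h₂).trans (le_of_eq ?_))
      rw [← hcard]
      push_cast
      ring

theorem norm_integral_le_of_pieces {E : Type*} [NormedAddCommGroup E] [NormedSpace ℝ E]
    {f : ℝ → E} {g : ℝ → ℝ} {C : ℝ} (hC : 0 ≤ C) (hf : Integrable f) (hg : Integrable g)
    (hg0 : ∀ x, 0 ≤ g x) (S : Finset ℝ)
    (h : ∀ a b, a ≤ b → (∀ s ∈ S, s ∉ Set.Ioo a b) →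
      ‖∫ x in a..b, f x‖ ≤ C + ∫ x in a..b, g x) :
    ‖∫ x, f x‖ ≤ (S.card + 1) * C + ∫ x, g x := by
  have hlim := (intervalIntegral_tendsto_integral hf Filter.tendsto_neg_atTop_atBot
    Filter.tendsto_id).norm
  refine le_of_tendsto hlim ((Filter.eventually_ge_atTop 0).mono fun n hn ↦ ?_)
  have hn' : -n ≤ n := by linarith
  refine (norm_intervalIntegral_le_of_pieces hf hg S h hn').trans (add_le_add ?_ ?_)
  · gcongr
    exact Finset.filter_subset _ _
  · rw [intervalIntegral.integral_of_le hn']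
    exact setIntegral_le_integral hg (Filter.Eventually.of_forall hg0)

theorem hasDerivAt_I_mul_sub (a : ℂ) (ξ : ℝ) :
    HasDerivAt (fun ξ : ℝ ↦ Complex.I * (ξ : ℂ) - a) Complex.I ξ := by
  simpa using ((Complex.ofRealCLM.hasDerivAt (x := ξ)).const_mul Complex.I).sub_const a

theorem abs_sub_im_le_norm (a : ℂ) (ξ : ℝ) : |ξ - a.im| ≤ ‖Complex.I * (ξ : ℂ) - a‖ := by
  simpa using Complex.abs_im_le_norm (Complex.I * (ξ : ℂ) - a)

/-- The oscillatory integral over an interval on which `exp ψ` is bounded and which stays at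
distance `δ` from the real parts of the stationary points of `ψ`. -/
theorem norm_intervalIntegral_exp_le {ι : Type*} (s : Finset ι) (A : ℂ) (r : ι → ℂ)
    {ψ : ℝ → ℂ}
    (hψ : ∀ ξ : ℝ, HasDerivAt ψ (A * ∏ i ∈ s, (Complex.I * (ξ : ℂ) - r i)) ξ)
    {δ : ℝ} (hδ : 0 < δ) (hA : 1 ≤ ‖A‖ * δ ^ (s.card + 1)) {a b : ℝ} (hab : a ≤ b)
    (hexp : ∀ ξ ∈ Set.Icc a b, ‖Complex.exp (ψ ξ)‖ ≤ 1)
    (hfar : ∀ ξ ∈ Set.Icc a b, ∀ i ∈ s, δ ≤ |ξ - (r i).im|) :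
    ‖∫ ξ in a..b, Complex.exp (ψ ξ)‖ ≤
      2 * δ + ∫ ξ in a..b, ∑ i ∈ s, 2 * (1 + ((ξ - (r i).im) / δ) ^ 2)⁻¹ := by
  classical
  set D : ℝ → ℂ := fun ξ ↦ A * ∏ i ∈ s, (Complex.I * (ξ : ℂ) - r i) with hD
  have hA0 : 0 < ‖A‖ := by
    by_contra! h
    nlinarith [pow_pos hδ (s.card + 1)]
  have hq : ∀ ξ ∈ Set.Icc a b, ∀ i ∈ s, δ ≤ ‖Complex.I * (ξ : ℂ) - r i‖ := fun ξ hξ i hi ↦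
    (hfar ξ hξ i hi).trans (abs_sub_im_le_norm _ _)
  have hq0 : ∀ ξ ∈ Set.Icc a b, ∀ i ∈ s, Complex.I * (ξ : ℂ) - r i ≠ 0 := fun ξ hξ i hi ↦
    norm_pos_iff.1 (hδ.trans_le (hq ξ hξ i hi))
  have hD0 : ∀ ξ ∈ Set.Icc a b, D ξ ≠ 0 := fun ξ hξ ↦
    mul_ne_zero (norm_pos_iff.1 hA0) (Finset.prod_ne_zero_iff.2 (hq0 ξ hξ))
  have hDnorm : ∀ ξ ∈ Set.Icc a b, ‖(D ξ)⁻¹‖ ≤ δ := by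
    intro ξ hξ
    rw [norm_inv]
    refine inv_le_of_inv_le₀ hδ ?_
    have : δ ^ s.card ≤ ∏ i ∈ s, ‖Complex.I * (ξ : ℂ) - r i‖ := by
      rw [← Finset.prod_const]
      exact Finset.prod_le_prod (fun _ _ ↦ hδ.le) (hq ξ hξ)
    calc δ⁻¹ ≤ δ⁻¹ * (‖A‖ * δ ^ (s.card + 1)) := le_mul_of_one_le_right (by positivity) hA
      _ = ‖A‖ * δ ^ s.card := by
        rw [pow_succ]
        field_simp
      _ ≤ ‖D ξ‖ := by
        rw [hD, norm_mul, norm_prod]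
        gcongr
  set V : ℝ → ℂ := fun ξ ↦ -∑ i ∈ s, Complex.I * ((Complex.I * (ξ : ℂ) - r i) * D ξ)⁻¹ with hV
  have hDcont : Continuous D := by fun_prop
  have hW : ∀ ξ ∈ Set.Icc a b, HasDerivAt (fun ξ ↦ (D ξ)⁻¹) (V ξ) ξ := by
    intro ξ hξ
    have h := ((HasDerivAt.fun_finsetProd (u := s)
      fun i _ ↦ hasDerivAt_I_mul_sub (r i) ξ).const_mul A).fun_inv (hD0 ξ hξ)
    convert! h using 1
    rw [neg_div, Finset.mul_sum, Finset.sum_div]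
    refine congrArg Neg.neg ?_
    refine Finset.sum_congr rfl fun i hi ↦ ?_
    have hDi : D ξ = (Complex.I * (ξ : ℂ) - r i) *
        (A * ∏ l ∈ s.erase i, (Complex.I * (ξ : ℂ) - r l)) := by
      rw [mul_left_comm,
        Finset.mul_prod_erase s (fun l ↦ Complex.I * (ξ : ℂ) - r l) hi]
    have h1 := hq0 ξ hξ i hi
    have h2 := hD0 ξ hξ
    change _ = A * _ / (D ξ) ^ 2
    rw [smul_eq_mul]
    field_simp
    rw [hDi]
    ring
  have hVnorm : ∀ ξ ∈ Set.Icc a b,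
      ‖V ξ‖ ≤ ∑ i ∈ s, 2 * (1 + ((ξ - (r i).im) / δ) ^ 2)⁻¹ := by
    intro ξ hξ
    rw [hV, norm_neg]
    refine (norm_sum_le _ _).trans (Finset.sum_le_sum fun i hi ↦ ?_)
    set u := |ξ - (r i).im| with hu
    have hδu : δ ≤ u := hfar ξ hξ i hi
    have hu0 : 0 < u := hδ.trans_le hδu
    have hprod : δ ^ (s.erase i).card ≤ ∏ l ∈ s.erase i, ‖Complex.I * (ξ : ℂ) - r l‖ := by
      rw [← Finset.prod_const]
      exact Finset.prod_le_prod (fun _ _ ↦ hδ.le) fun l hl ↦ hq ξ hξ l (Finset.mem_of_mem_erase hl)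
    have hcard := Finset.card_erase_add_one hi
    have hDi : u * (‖A‖ * δ ^ (s.erase i).card) ≤ ‖D ξ‖ := by
      rw [hD, norm_mul, norm_prod, ← Finset.mul_prod_erase s _ hi, mul_left_comm]
      have := abs_sub_im_le_norm (r i) ξ
      gcongr
    have hkey : (u / δ) ^ 2 ≤ ‖Complex.I * (ξ : ℂ) - r i‖ * ‖D ξ‖ :=
      calc (u / δ) ^ 2 ≤ (u / δ) ^ 2 * (‖A‖ * δ ^ (s.card + 1)) :=
            le_mul_of_one_le_right (by positivity) hA
        _ = u * (u * (‖A‖ * δ ^ (s.erase i).card)) := by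
            rw [← hcard]
            field_simp
            ring
        _ ≤ _ := mul_le_mul (abs_sub_im_le_norm _ _) hDi (by positivity) (norm_nonneg _)
    have h1 : 1 ≤ (u / δ) ^ 2 := one_le_pow₀ ((one_le_div hδ).2 hδu)
    have husq : ((ξ - (r i).im) / δ) ^ 2 = (u / δ) ^ 2 := by
      rw [hu, div_pow, div_pow, sq_abs]
    rw [husq, norm_mul, Complex.norm_I, one_mul, norm_inv, norm_mul, ← div_eq_mul_inv]
    refine (inv_anti₀ (by positivity) hkey).trans ?_
    rw [inv_eq_one_div, div_le_div_iff₀ (by positivity) (by positivity)]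
    linarith
  have hψc : Continuous ψ := continuous_iff_continuousAt.2 fun ξ ↦ (hψ ξ).continuousAt
  have hVc : ContinuousOn V (Set.Icc a b) := by
    refine (continuousOn_finsetSum _ fun i hi ↦ continuousOn_const.mul
      (ContinuousOn.inv₀ (by fun_prop) fun ξ hξ ↦ ?_)).neg
    exact mul_ne_zero (hq0 ξ hξ i hi) (hD0 ξ hξ)
  have hVi : IntervalIntegrable (fun ξ ↦ Complex.exp (ψ ξ) * V ξ) volume a b := by
    apply ContinuousOn.intervalIntegrable
    rw [Set.uIcc_of_le hab]
    exact (by fun_prop : Continuous fun ξ ↦ Complex.exp (ψ ξ)).continuousOn.mul hVc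
  have hei : IntervalIntegrable (fun ξ ↦ Complex.exp (ψ ξ)) volume a b :=
    (by fun_prop : Continuous fun ξ ↦ Complex.exp (ψ ξ)).intervalIntegrable _ _
  have hftc := intervalIntegral.integral_eq_sub_of_hasDerivAt
    (f := fun ξ ↦ Complex.exp (ψ ξ) * (D ξ)⁻¹)
    (f' := fun ξ ↦ Complex.exp (ψ ξ) + Complex.exp (ψ ξ) * V ξ) (a := a) (b := b)
    (fun ξ hξ ↦ by
      rw [Set.uIcc_of_le hab] at hξ
      convert! (hψ ξ).cexp.mul (hW ξ hξ) using 1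
      rw [mul_assoc, mul_inv_cancel₀ (hD0 ξ hξ), mul_one]) (hei.add hVi)
  rw [intervalIntegral.integral_add hei hVi] at hftc
  have hend : ∀ ξ ∈ Set.Icc a b, ‖Complex.exp (ψ ξ) * (D ξ)⁻¹‖ ≤ δ := fun ξ hξ ↦ by
    rw [norm_mul]
    exact (mul_le_mul (hexp ξ hξ) (hDnorm ξ hξ) (norm_nonneg _) zero_le_one).trans_eq (one_mul δ)
  have hVint : ‖∫ ξ in a..b, Complex.exp (ψ ξ) * V ξ‖ ≤
      ∫ ξ in a..b, ∑ i ∈ s, 2 * (1 + ((ξ - (r i).im) / δ) ^ 2)⁻¹ := by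
    refine intervalIntegral.norm_integral_le_of_norm_le hab
      (Filter.Eventually.of_forall fun ξ hξ ↦ ?_) ?_
    · have hξ' := Set.Ioc_subset_Icc_self hξ
      rw [norm_mul]
      exact (mul_le_of_le_one_left (norm_nonneg _) (hexp ξ hξ')).trans (hVnorm ξ hξ')
    · refine (continuous_finsetSum _ fun i _ ↦ continuous_const.mul
        (Continuous.inv₀ (by fun_prop) fun ξ ↦ ?_)).intervalIntegrable _ _
      positivity
  rw [eq_sub_of_add_eq hftc]
  calc _ ≤ ‖Complex.exp (ψ b) * (D b)⁻¹‖ + ‖Complex.exp (ψ a) * (D a)⁻¹‖ +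
        ‖∫ ξ in a..b, Complex.exp (ψ ξ) * V ξ‖ :=
      (norm_sub_le _ _).trans (add_le_add_left (norm_sub_le _ _) _)
    _ ≤ _ := by
      linarith [hend a (Set.left_mem_Icc.2 hab), hend b (Set.right_mem_Icc.2 hab)]

/-- A van der Corput type bound for a phase with polynomial derivative, cut off to a region where
`exp ψ` is bounded; the region is described by the finite set `Z` of its boundary points. -/
theorem norm_integral_le_of_cutoff_exp {ι : Type*} (s : Finset ι) (A : ℂ) (r : ι → ℂ)
    {ψ : ℝ → ℂ}
    (hψ : ∀ ξ : ℝ, HasDerivAt ψ (A * ∏ i ∈ s, (Complex.I * (ξ : ℂ) - r i)) ξ)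
    {δ : ℝ} (hδ : 0 < δ) (hA : 1 ≤ ‖A‖ * δ ^ (s.card + 1))
    {f : ℝ → ℂ} (hf1 : ∀ ξ, ‖f ξ‖ ≤ 1) (Z : Finset ℝ)
    (hZ : ∀ a b, (∀ z ∈ Z, z ∉ Set.Ioo a b) →
      (∀ ξ ∈ Set.Ioo a b, f ξ = 0) ∨ ∀ ξ ∈ Set.Ioo a b, f ξ = Complex.exp (ψ ξ)) :
    ‖∫ ξ, f ξ‖ ≤ ((Z.card + 2 * s.card + 1) * 2 + 2 * Real.pi * s.card) * δ := by
  classical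
  by_cases hf : Integrable f
  swap
  · rw [integral_undef hf, norm_zero]
    positivity
  have hψc : Continuous ψ := continuous_iff_continuousAt.2 fun ξ ↦ (hψ ξ).continuousAt
  have hgi : ∀ i, Integrable fun ξ : ℝ ↦ 2 * (1 + ((ξ - (r i).im) / δ) ^ 2)⁻¹ := fun i ↦
    ((integrable_inv_one_add_sq.comp_div hδ.ne').comp_sub_right (r i).im).const_mul 2
  have hgint : ∀ i, ∫ ξ : ℝ, 2 * (1 + ((ξ - (r i).im) / δ) ^ 2)⁻¹ = 2 * Real.pi * δ := by
    intro i
    rw [integral_const_mul, integral_sub_right_eq_self (fun ξ ↦ (1 + (ξ / δ) ^ 2)⁻¹),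
      Measure.integral_comp_div (fun ξ ↦ (1 + ξ ^ 2)⁻¹), integral_univ_inv_one_add_sq,
      abs_of_pos hδ, smul_eq_mul]
    ring
  set g : ℝ → ℝ := fun ξ ↦ ∑ i ∈ s, 2 * (1 + ((ξ - (r i).im) / δ) ^ 2)⁻¹ with hg
  have hg0 : ∀ ξ, 0 ≤ g ξ := fun ξ ↦ Finset.sum_nonneg fun i _ ↦ by positivity
  have hgI : Integrable g := integrable_finsetSum _ fun i _ ↦ hgi i
  set S : Finset ℝ :=
    Z ∪ (s.image (fun i ↦ (r i).im - δ) ∪ s.image (fun i ↦ (r i).im + δ)) with hS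
  have hScard : (S.card : ℝ) ≤ Z.card + 2 * s.card := by
    have : S.card ≤ Z.card + (s.card + s.card) :=
      (Finset.card_union_le _ _).trans (add_le_add_right ((Finset.card_union_le _ _).trans
        (add_le_add Finset.card_image_le Finset.card_image_le)) _)
    have : (S.card : ℝ) ≤ Z.card + (s.card + s.card) := by exact_mod_cast this
    linarith
  have hmain := norm_integral_le_of_pieces (C := 2 * δ) (by positivity) hf hgI hg0 S
    fun a b hab hSab ↦ by
      have hpos : 0 ≤ ∫ ξ in a..b, g ξ :=
        intervalIntegral.integral_nonneg hab fun ξ _ ↦ hg0 ξ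
      obtain rfl | hlt := hab.eq_or_lt
      · simp [hδ.le]
      obtain hzero | hexp := hZ a b fun z hz ↦ hSab z (Finset.mem_union_left _ hz)
      · rw [intervalIntegral.integral_congr_Ioo_of_le hab hzero, intervalIntegral.integral_zero,
          norm_zero]
        positivity
      by_cases hnear : ∃ i ∈ s, ∃ ξ ∈ Set.Ioo a b, |ξ - (r i).im| < δ
      · obtain ⟨i, hi, ξ₀, hξ₀, hlt₀⟩ := hnear
        have h₁ := hSab ((r i).im - δ)
          (by simp only [hS, Finset.mem_union, Finset.mem_image]; grind)
        have h₂ := hSab ((r i).im + δ)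
          (by simp only [hS, Finset.mem_union, Finset.mem_image]; grind)
        have hsub : ∀ ξ ∈ Set.Ioc a b, |ξ - (r i).im| ≤ δ := by
          intro ξ hξ
          rw [abs_lt] at hlt₀
          simp only [Set.mem_Ioo, Set.mem_Ioc, not_and, not_lt] at h₁ h₂ hξ₀ hξ
          rw [abs_le]
          constructor
          · by_contra! h
            linarith [h₁ (by linarith)]
          · by_contra! h
            linarith [h₂ (by linarith)]
        refine (intervalIntegral.norm_integral_le_of_norm_le hab
          (Filter.Eventually.of_forall fun ξ hξ ↦ ?_) hgI.intervalIntegrable).trans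
          (le_add_of_nonneg_left (by positivity))
        refine (hf1 ξ).trans (le_trans ?_ (Finset.single_le_sum
          (f := fun i ↦ 2 * (1 + ((ξ - (r i).im) / δ) ^ 2)⁻¹) (fun i _ ↦ by positivity) hi))
        have hle : ((ξ - (r i).im) / δ) ^ 2 ≤ 1 := by
          rw [← sq_abs, abs_div, abs_of_pos hδ]
          exact pow_le_one₀ (by positivity) ((div_le_one hδ).2 (hsub ξ hξ))
        rw [← div_eq_mul_inv, le_div_iff₀ (by positivity)]
        linarith
      · push Not at hnear
        rw [intervalIntegral.integral_congr_Ioo_of_le hab hexp]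
        refine norm_intervalIntegral_exp_le s A r hψ hδ hA hab ?_ ?_
        · rw [← closure_Ioo hlt.ne]
          refine fun ξ hξ ↦ closure_minimal (t := {ξ | ‖Complex.exp (ψ ξ)‖ ≤ 1})
            (fun ξ hξ ↦ ?_) (isClosed_le (by fun_prop) continuous_const) hξ
          simpa [hexp ξ hξ] using hf1 ξ
        · rw [← closure_Ioo hlt.ne]
          refine fun ξ hξ i hi ↦ closure_minimal (t := {ξ | δ ≤ |ξ - (r i).im|})
            (hnear i hi) (isClosed_le continuous_const (by fun_prop)) hξ
  refine hmain.trans ?_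
  rw [hg, integral_finsetSum _ fun i _ ↦ hgi i, Finset.sum_congr rfl fun i _ ↦ hgint i,
    Finset.sum_const, nsmul_eq_mul]
  have : (S.card + 1) * (2 * δ) ≤ (Z.card + 2 * s.card + 1) * (2 * δ) := by gcongr
  linarith

/-- The real part of `(iξ - 1) ^ k` vanishes at finitely many real `ξ` only. -/
theorem finite_setOf_re_I_mul_sub_one_pow_eq_zero {k : ℕ} (hk : k ≠ 0) :
    {ξ : ℝ | ((Complex.I * (ξ : ℂ) - 1) ^ k).re = 0}.Finite := by
  set p : Polynomial ℂ := (Polynomial.C Complex.I * Polynomial.X - 1) ^ k +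
    (-(Polynomial.C Complex.I * Polynomial.X) - 1) ^ k with hp
  have hp0 : p ≠ 0 := by
    intro h
    have := congrArg (Polynomial.eval Complex.I) h
    simp [hp, hk] at this
    norm_num at this
  refine ((Polynomial.finite_setOfPred_isRoot hp0).preimage
    Complex.ofReal_injective.injOn).subset fun ξ hξ ↦ ?_
  have hconj := Complex.add_conj ((Complex.I * (ξ : ℂ) - 1) ^ k)
  rw [hξ] at hconj
  simpa [hp, Polynomial.IsRoot] using hconj

/-- The derivative of the phase `ixξ - t(iξ - 1)^{n+1}` splits into linear factors. -/
theorem exists_hasDerivAt_phase {n : ℕ} (hn : 0 < n) {t : ℝ} (ht : t ≠ 0) (x : ℝ) :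
    ∃ r : ℂ → ℂ, ∀ ξ : ℝ, HasDerivAt (fun ξ : ℝ ↦ Complex.I * (x : ℂ) * (ξ : ℂ) -
        (t : ℂ) * (Complex.I * (ξ : ℂ) - 1) ^ (n + 1))
      (-(Complex.I * t * (n + 1)) *
        ∏ ζ ∈ Polynomial.nthRootsFinset n (1 : ℂ), (Complex.I * (ξ : ℂ) - r ζ)) ξ := by
  have ht' : (t : ℂ) ≠ 0 := by exact_mod_cast ht
  have hn' : (n : ℂ) + 1 ≠ 0 := by exact_mod_cast n.succ_ne_zero
  obtain ⟨w, hw⟩ := IsAlgClosed.exists_pow_nat_eq ((x : ℂ) / (t * (n + 1))) hn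
  refine ⟨fun ζ ↦ 1 + ζ * w, fun ξ ↦ ?_⟩
  have hfac := (Complex.isPrimitiveRoot_exp n hn.ne').pow_sub_pow_eq_prod_sub_mul
    (Complex.I * (ξ : ℂ) - 1) w hn
  have hlin : HasDerivAt (fun ξ : ℝ ↦ Complex.I * (x : ℂ) * (ξ : ℂ)) (Complex.I * x) ξ := by
    simpa using (Complex.ofRealCLM.hasDerivAt (x := ξ)).const_mul (Complex.I * (x : ℂ))
  convert! hlin.sub (((hasDerivAt_I_mul_sub 1 ξ).pow (n + 1)).const_mul (t : ℂ)) using 1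
  simp_rw [← sub_sub]
  rw [← hfac, hw]
  push_cast
  field_simp
  ring

open Classical in
theorem exists_norm_integral_cutoff_exp_le {n : ℕ} (hn : 0 < n) : ∃ c : ℝ, 0 < c ∧
    ∀ (x t : ℝ), t ≠ 0 → ∀ Q : ℝ → Prop,
      (∀ y, Q y → 0 ≤ t * y) → (∀ y z, 0 < y → 0 < z → (Q y ↔ Q z)) →
      (∀ y z, y < 0 → z < 0 → (Q y ↔ Q z)) →
      ‖∫ ξ : ℝ, if Q ((Complex.I * (ξ : ℂ) - 1) ^ (n + 1)).re then
        Complex.exp (Complex.I * (x : ℂ) * (ξ : ℂ) -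
          (t : ℂ) * (Complex.I * (ξ : ℂ) - 1) ^ (n + 1)) else 0‖ ≤
        c * |t| ^ (-(1 / ((n : ℝ) + 1))) := by
  set Z := (finite_setOf_re_I_mul_sub_one_pow_eq_zero n.succ_ne_zero).toFinset with hZ
  set s := Polynomial.nthRootsFinset n (1 : ℂ)
  have hcard : s.card = n := (Complex.isPrimitiveRoot_exp n hn.ne').card_nthRootsFinset
  refine ⟨(Z.card + 2 * s.card + 1) * 2 + 2 * Real.pi * s.card, by positivity,
    fun x t ht Q hQ hQpos hQneg ↦ ?_⟩
  obtain ⟨r, hr⟩ := exists_hasDerivAt_phase hn ht x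
  have ht0 : 0 < |t| := abs_pos.2 ht
  refine norm_integral_le_of_cutoff_exp s _ r hr (Real.rpow_pos_of_pos ht0 _) ?_ ?_ Z ?_
  · rw [hcard, ← Real.rpow_natCast, ← Real.rpow_mul ht0.le]
    have hexp : -(1 / ((n : ℝ) + 1)) * ((n + 1 : ℕ) : ℝ) = -1 := by
      push_cast
      field_simp
    have hnorm : ‖(n : ℂ) + 1‖ = n + 1 := by
      exact_mod_cast Complex.norm_natCast (n + 1)
    rw [hexp, Real.rpow_neg_one, norm_neg, norm_mul, norm_mul, Complex.norm_I, one_mul,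
      Complex.norm_real, Real.norm_eq_abs, hnorm, mul_right_comm, mul_inv_cancel₀ ht0.ne']
    linarith [n.cast_nonneg (α := ℝ)]
  · intro ξ
    split_ifs with h
    · rw [Complex.norm_exp, Real.exp_le_one_iff]
      have := hQ _ h
      simp only [Complex.sub_re, Complex.re_ofReal_mul]
      simpa using this
    · simp
  · intro a b hab
    set p : ℝ → ℝ := fun ξ ↦ ((Complex.I * (ξ : ℂ) - 1) ^ (n + 1)).re with hp
    have hpc : Continuous p := by fun_prop
    have hp0 : ∀ ξ ∈ Set.Ioo a b, p ξ ≠ 0 := fun ξ hξ h ↦ hab ξ (by simpa [hZ] using h) hξ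
    have hiff : ∀ ξ ∈ Set.Ioo a b, ∀ η ∈ Set.Ioo a b, (Q (p ξ) ↔ Q (p η)) := by
      intro ξ hξ η hη
      have hivt : ∀ ξ ∈ Set.Ioo a b, ∀ η ∈ Set.Ioo a b, p ξ < 0 → ¬ 0 < p η := by
        intro ξ hξ η hη h₁ h₂
        obtain ⟨y, hy, hy0⟩ := isPreconnected_Ioo.intermediate_value hξ hη hpc.continuousOn
          ⟨h₁.le, h₂.le⟩
        exact hp0 y hy hy0
      rcases (hp0 ξ hξ).lt_or_gt with h₁ | h₁ <;> rcases (hp0 η hη).lt_or_gt with h₂ | h₂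
      · exact hQneg _ _ h₁ h₂
      · exact (hivt ξ hξ η hη h₁ h₂).elim
      · exact (hivt η hη ξ hξ h₂ h₁).elim
      · exact hQpos _ _ h₁ h₂
    by_cases hex : ∃ ξ ∈ Set.Ioo a b, Q (p ξ)
    · obtain ⟨ξ₀, hξ₀, hQ₀⟩ := hex
      exact Or.inr fun ξ hξ ↦ if_pos ((hiff ξ hξ ξ₀ hξ₀).2 hQ₀)
    · push Not at hex
      exact Or.inl fun ξ hξ ↦ if_neg (hex ξ hξ)

theorem stmt16 (j : ℕ) (hj : 0 < j) : ∃ c : ℝ, 0 < c ∧ ∀ x t : ℝ, t ≠ 0 →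
    ‖Kplus j x t‖ ≤ c * |t| ^ (-(1 / (2 * (j : ℝ) + 1))) ∧
    ‖Kminus j x t‖ ≤ c * |t| ^ (-(1 / (2 * (j : ℝ) + 1))) := by
  obtain ⟨c, hc, h⟩ := exists_norm_integral_cutoff_exp_le (n := 2 * j) (by omega)
  push_cast at h
  refine ⟨c, hc, fun x t ht ↦ ⟨?_, ?_⟩⟩
  · unfold Kplus
    split_ifs with ht0
    · exact h x t ht (fun y ↦ 0 ≤ y) (fun y hy ↦ mul_nonneg ht0 hy)
        (fun y z hy hz ↦ iff_of_true hy.le hz.le)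
        (fun y z hy hz ↦ iff_of_false hy.not_ge hz.not_ge)
    · rw [norm_zero]
      positivity
  · unfold Kminus
    split_ifs with ht0
    · exact h x t ht (fun y ↦ y < 0) (fun y hy ↦ (mul_pos_of_neg_of_neg ht0 hy).le)
        (fun y z hy hz ↦ iff_of_false hy.not_gt hz.not_gt)
        (fun y z hy hz ↦ iff_of_true hy hz)
    · rw [norm_zero]
      positivity
end
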